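/- Let ω = (√5 − 1)/2, κ = 1.3 and ε = 1. Then there exists a real-analytic, 1-periodic map K : ℝ → ℝ² satisfying F(K(θ − ω), θ − ω) = K(θ) for all θ ∈ ℝ, and there exist a real-analytic, 1-periodic map P : ℝ → Matrix(2, 2, ℝ) with P(θ) invertible for every θ, and real numbers λ_s, λ_u with |λ_s| ≤ 0.447 and |λ_u| ≥ 2.237 (in particular |λ_s| < 1 < |λ_u|), such that D_{(x,y)}F(K(θ − ω), θ − ω)·P(θ − ω) = P(θ)·diag(λ_s, λ_u) for all θ ∈ ℝ. That is, the perturbed standard map has a real-analytic fiberwise hyperbolic invariant torus with constant diagonal reduced linearized dynamics for these parameter values. -/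

import Mathlib

/-- The perturbed standard map `F : ℝ² × ℝ → ℝ²`. -/
noncomputable def stdF (κ ε : ℝ) (x y θ : ℝ) : ℝ × ℝ :=
  (x + y - κ / (2 * Real.pi) * Real.sin (2 * Real.pi * x) - ε * Real.sin (2 * Real.pi * θ),
   y - κ / (2 * Real.pi) * Real.sin (2 * Real.pi * x) - ε * Real.sin (2 * Real.pi * θ))

/-- Jacobian of `F` with respect to `(x, y)` at `(x, y, θ)`. -/
noncomputable def stdDF (κ : ℝ) (x : ℝ) : Matrix (Fin 2) (Fin 2) ℝ :=
  !![1 - κ * Real.cos (2 * Real.pi * x), 1;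
     -(κ * Real.cos (2 * Real.pi * x)), 1]

/-! ### Trigonometric polynomials with Gaussian rational coefficients -/

/-- Gaussian rationals, with computable arithmetic. -/
structure GaussRat where
  re : ℚ
  im : ℚ

namespace GaussRat

instance : DecidableEq GaussRat := fun a b =>
  decidable_of_iff (a.re = b.re ∧ a.im = b.im) (by cases a; cases b; simp)

/-- The complex number represented by a Gaussian rational. -/
noncomputable def toC (a : GaussRat) : ℂ := (a.re : ℂ) + (a.im : ℂ) * Complex.I

/-- Addition of Gaussian rationals. -/
def add (a b : GaussRat) : GaussRat := ⟨a.re + b.re, a.im + b.im⟩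

/-- Multiplication of Gaussian rationals. -/
def mul (a b : GaussRat) : GaussRat := ⟨a.re * b.re - a.im * b.im, a.re * b.im + a.im * b.re⟩

/-- Complex conjugation of Gaussian rationals. -/
def conj (a : GaussRat) : GaussRat := ⟨a.re, -a.im⟩

/-- Natural powers of a Gaussian rational. -/
def npow (a : GaussRat) : ℕ → GaussRat
  | 0 => ⟨1, 0⟩
  | n + 1 => mul a (npow a n)

/-- The `ℓ¹` size of a Gaussian rational. -/
def size (a : GaussRat) : ℚ := |a.re| + |a.im|

lemma toC_add (a b : GaussRat) : (a.add b).toC = a.toC + b.toC := by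
  simp only [toC, add]; push_cast; ring

lemma toC_mul (a b : GaussRat) : (a.mul b).toC = a.toC * b.toC := by
  simp only [toC, mul]; push_cast
  linear_combination (-(a.im : ℂ) * b.im) * Complex.I_sq

lemma toC_conj (a : GaussRat) : a.conj.toC = (starRingEnd ℂ) a.toC := by
  simp [toC, conj]

lemma toC_npow (a : GaussRat) (n : ℕ) : (a.npow n).toC = a.toC ^ n := by
  induction n with
  | zero => simp [npow, toC]
  | succ n ih => rw [npow, toC_mul, ih, pow_succ']

lemma norm_toC_le (a : GaussRat) : ‖a.toC‖ ≤ (a.size : ℝ) := by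
  have h1 : ‖(a.re : ℂ)‖ = |(a.re : ℝ)| := by
    rw [← Complex.ofReal_ratCast, Complex.norm_real, Real.norm_eq_abs]
  have h2 : ‖(a.im : ℂ)‖ = |(a.im : ℝ)| := by
    rw [← Complex.ofReal_ratCast, Complex.norm_real, Real.norm_eq_abs]
  calc ‖a.toC‖ ≤ ‖(a.re : ℂ)‖ + ‖(a.im : ℂ) * Complex.I‖ := norm_add_le _ _
    _ = (a.size : ℝ) := by rw [norm_mul, Complex.norm_I, mul_one, h1, h2, size]; push_cast; ring

end GaussRat

/-- Value at `x` of the trigonometric polynomial with the given list of coefficients, the first of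
which has frequency `k`. -/
noncomputable def trigEval : List GaussRat → ℤ → ℂ → ℂ
  | [], _, _ => 0
  | a :: l, k, x => a.toC * Complex.exp (Complex.I * k * x) + trigEval l (k + 1) x

namespace TrigList

/-- Termwise sum of coefficient lists. -/
def add : List GaussRat → List GaussRat → List GaussRat
  | [], m => m
  | a :: l, [] => a :: l
  | a :: l, b :: m => a.add b :: add l m

/-- Multiple of a coefficient list. -/
def smul (c : GaussRat) (l : List GaussRat) : List GaussRat := l.map c.mul

/-- Product of coefficient lists. -/
def mul : List GaussRat → List GaussRat → List GaussRat
  | [], _ => []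
  | a :: l, m => add (smul a m) (⟨0, 0⟩ :: mul l m)

/-- Prepend `n` zero coefficients. -/
def pad : ℕ → List GaussRat → List GaussRat
  | 0, l => l
  | n + 1, l => ⟨0, 0⟩ :: pad n l

/-- Multiply each coefficient by its frequency. -/
def freq : ℤ → List GaussRat → List GaussRat
  | _, [] => []
  | k, a :: l => GaussRat.mul ⟨k, 0⟩ a :: freq (k + 1) l

/-- Multiply each coefficient by a frequency-dependent factor. -/
def twist (c : ℤ → GaussRat) : ℤ → List GaussRat → List GaussRat
  | _, [] => []
  | k, a :: l => GaussRat.mul (c k) a :: twist c (k + 1) l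

/-- The sum of the sizes of the coefficients. -/
def size : List GaussRat → ℚ
  | [] => 0
  | a :: l => a.size + size l

/-- The sum of the coefficients. -/
def sum : List GaussRat → GaussRat
  | [] => ⟨0, 0⟩
  | a :: l => a.add (sum l)

end TrigList

open TrigList

lemma trigEval_add (l m : List GaussRat) (k : ℤ) (x : ℂ) :
    trigEval (add l m) k x = trigEval l k x + trigEval m k x := by
  induction l generalizing m k with
  | nil => simp [add, trigEval]
  | cons a l ih =>
    cases m with
    | nil => simp [add, trigEval]
    | cons b m => simp only [add, trigEval, ih, GaussRat.toC_add]; ring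

lemma trigEval_smul (c : GaussRat) (l : List GaussRat) (k : ℤ) (x : ℂ) :
    trigEval (smul c l) k x = c.toC * trigEval l k x := by
  induction l generalizing k with
  | nil => simp [smul, trigEval]
  | cons a l ih =>
    have ih' := ih (k + 1)
    simp only [smul] at ih'
    simp only [smul, List.map_cons, trigEval, ih', GaussRat.toC_mul]; ring

lemma trigEval_zero_cons (l : List GaussRat) (k : ℤ) (x : ℂ) :
    trigEval (⟨0, 0⟩ :: l) k x = trigEval l (k + 1) x := by
  simp [trigEval, GaussRat.toC]

lemma trigEval_shift (l : List GaussRat) (j k : ℤ) (x : ℂ) :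
    trigEval l (j + k) x = Complex.exp (Complex.I * j * x) * trigEval l k x := by
  induction l generalizing k with
  | nil => simp [trigEval]
  | cons a l ih =>
    simp only [trigEval]
    rw [add_assoc, ih, mul_add, mul_left_comm, ← Complex.exp_add]
    congr 3
    push_cast; ring

lemma trigEval_mul (l m : List GaussRat) (j k : ℤ) (x : ℂ) :
    trigEval (mul l m) (j + k) x = trigEval l j x * trigEval m k x := by
  induction l generalizing j with
  | nil => simp [mul, trigEval]
  | cons a l ih =>
    simp only [mul]
    rw [trigEval_add, trigEval_smul, trigEval_zero_cons, show j + k + 1 = (j + 1) + k by ring, ih,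
      trigEval_shift]
    simp only [trigEval]; ring

lemma trigEval_pad (n : ℕ) (l : List GaussRat) (k : ℤ) (x : ℂ) :
    trigEval (pad n l) (k - n) x = trigEval l k x := by
  induction n generalizing k with
  | zero => simp [pad]
  | succ n ih =>
    rw [pad, trigEval_zero_cons, ← ih]
    congr 1
    push_cast; ring

lemma trigEval_append (l m : List GaussRat) (k : ℤ) (x : ℂ) :
    trigEval (l ++ m) k x = trigEval l k x + trigEval m (k + l.length) x := by
  induction l generalizing k with
  | nil => simp [trigEval]
  | cons a l ih =>
    simp only [List.cons_append, trigEval, ih, List.length_cons]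
    rw [← add_assoc, show k + ((l.length + 1 : ℕ) : ℤ) = k + 1 + l.length by push_cast; ring]

lemma trigEval_neg (l : List GaussRat) (k : ℤ) (x : ℂ) :
    trigEval l k (-x) = trigEval l.reverse (-(k + l.length - 1)) x := by
  induction l generalizing k with
  | nil => simp [trigEval]
  | cons a l ih =>
    simp only [List.reverse_cons, trigEval_append, trigEval, ih, List.length_reverse,
      List.length_cons]
    rw [add_comm, add_zero]
    congr 2
    · push_cast; ring
    · congr 1; push_cast; ring

lemma conj_trigEval (l : List GaussRat) (k : ℤ) (x : ℂ) :
    (starRingEnd ℂ) (trigEval l k x)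
      = trigEval (l.map GaussRat.conj) k (-(starRingEnd ℂ) x) := by
  induction l generalizing k with
  | nil => simp [trigEval]
  | cons a l ih =>
    simp only [trigEval, map_add, map_mul, List.map_cons, ih, GaussRat.toC_conj,
      ← Complex.exp_conj, Complex.conj_I, map_intCast]
    congr 3
    ring

lemma hasDerivAt_trigEval (l : List GaussRat) (k : ℤ) (x : ℂ) :
    HasDerivAt (trigEval l k) (Complex.I * trigEval (freq k l) k x) x := by
  induction l generalizing k with
  | nil => simpa [trigEval, freq] using hasDerivAt_const x (0 : ℂ)
  | cons a l ih =>
    have h1 : HasDerivAt (fun x => a.toC * Complex.exp (Complex.I * k * x))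
        (a.toC * (Complex.exp (Complex.I * k * x) * (Complex.I * k))) x := by
      have := ((hasDerivAt_id x).const_mul (Complex.I * k)).cexp.const_mul a.toC
      simpa using this
    refine (h1.add (ih (k + 1))).congr_deriv ?_
    simp only [freq, trigEval, GaussRat.toC_mul]
    have : (GaussRat.toC ⟨(k : ℚ), 0⟩) = (k : ℂ) := by simp [GaussRat.toC]
    rw [this]; ring

lemma norm_exp_I_int_mul (k : ℤ) (x : ℝ) : ‖Complex.exp (Complex.I * k * x)‖ = 1 := by
  have : Complex.I * k * x = ((k * x : ℝ) : ℂ) * Complex.I := by push_cast; ring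
  rw [this, Complex.norm_exp_ofReal_mul_I]

lemma norm_trigEval_le (l : List GaussRat) (k : ℤ) (x : ℝ) :
    ‖trigEval l k x‖ ≤ (TrigList.size l : ℝ) := by
  induction l generalizing k with
  | nil => simp [trigEval, TrigList.size]
  | cons a l ih =>
    simp only [trigEval, TrigList.size]
    push_cast
    refine (norm_add_le _ _).trans (add_le_add ?_ (ih _))
    rw [norm_mul, norm_exp_I_int_mul, mul_one]
    exact a.norm_toC_le

lemma norm_trigEval_le_of_size_le {l : List GaussRat} {b : ℚ} (h : TrigList.size l ≤ b) (k : ℤ)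
    (x : ℝ) : ‖trigEval l k x‖ ≤ (b : ℝ) :=
  (norm_trigEval_le l k x).trans (by exact_mod_cast h)

lemma trigEval_periodic (l : List GaussRat) (k : ℤ) :
    Function.Periodic (trigEval l k) (2 * Real.pi) := by
  intro x
  induction l generalizing k with
  | nil => simp [trigEval]
  | cons a l ih =>
    simp only [trigEval, ih]
    congr 2
    rw [show Complex.I * k * (x + 2 * Real.pi)
        = Complex.I * k * x + k * (2 * Real.pi * Complex.I) by
      ring]
    exact Complex.exp_periodic.int_mul k _

lemma trigEval_at_zero (l : List GaussRat) (k : ℤ) :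
    trigEval l k 0 = (TrigList.sum l).toC := by
  induction l generalizing k with
  | nil => simp [trigEval, TrigList.sum, GaussRat.toC]
  | cons a l ih => simp [trigEval, TrigList.sum, GaussRat.toC_add, ih]

/-- Translating a trigonometric polynomial amounts, up to a small error, to multiplying its
coefficients by approximations `c k` of `exp (i k s)`. -/
lemma norm_trigEval_translate_sub_le {s τ : ℝ} {c : ℤ → GaussRat}
    (hc : ∀ k : ℤ, ‖Complex.exp (Complex.I * k * s) - (c k).toC‖ ≤ |(k : ℝ)| * τ)
    (l : List GaussRat) (k : ℤ) (x : ℝ) :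
    ‖trigEval l k (x + s) - trigEval (twist c k l) k x‖ ≤ (TrigList.size (freq k l) : ℝ) * τ := by
  induction l generalizing k with
  | nil => simp [trigEval, twist, freq, TrigList.size]
  | cons a l ih =>
    simp only [trigEval, twist, freq, TrigList.size]
    have hsplit : a.toC * Complex.exp (Complex.I * k * (x + s)) + trigEval l (k + 1) (x + s) -
        (((c k).mul a).toC * Complex.exp (Complex.I * k * x)
          + trigEval (twist c (k + 1) l) (k + 1) x)
        = (Complex.exp (Complex.I * k * s) - (c k).toC) * (a.toC * Complex.exp (Complex.I * k * x))
          + (trigEval l (k + 1) (x + s) - trigEval (twist c (k + 1) l) (k + 1) x) := by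
      rw [mul_add, Complex.exp_add, GaussRat.toC_mul]; ring
    rw [hsplit]
    push_cast
    rw [add_mul]
    refine (norm_add_le _ _).trans (add_le_add ?_ (ih _))
    rw [norm_mul, norm_mul, norm_exp_I_int_mul, mul_one]
    have hsize : ((GaussRat.mul ⟨(k : ℚ), 0⟩ a).size : ℝ) = |(k : ℝ)| * (a.size : ℝ) := by
      simp only [GaussRat.mul, GaussRat.size, zero_mul, sub_zero, add_zero, abs_mul]
      push_cast; ring
    rw [hsize]
    calc _ ≤ |(k : ℝ)| * τ * (a.size : ℝ) :=
          mul_le_mul (hc k) a.norm_toC_le (norm_nonneg _) ((norm_nonneg _).trans (hc k))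
      _ = _ := by ring

/-! ### The approximate torus and its certificates -/

/-- Sine coefficients, in units of `10⁻⁹`, of the approximate torus. -/
def torusSines : List ℤ :=
  [1409471447, 0, -92791902, 0, 22872786, 0, -2044573, 0, 241368, 0, -85596, 0, 48283, 0, -5762,
   0, 721]

/-- Coefficients, from frequency `-17` to `17`, of the approximate torus. -/
def torusCoeffs : List GaussRat :=
  (torusSines.reverse.map fun n => ⟨0, mkRat n 2000000000⟩) ++
    ⟨0, 0⟩ :: torusSines.map fun n => ⟨0, mkRat (-n) 2000000000⟩

/-- Coefficients, from frequency `-26` to `26`, of a trigonometric polynomial approximating the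
exponential of `i` times the approximate torus. -/
def expCoeffs : List GaussRat :=
  List.map (fun n : ℤ => ⟨mkRat n 100000000000, 0⟩)
  [-42, -4, 313, -103, -1801, 2017, 9155, -24643, -10741, 107876, -35583, -499875, 955402, 86564,
   -1288669, -4613750, -750208, 35728905, -12958887, -229763863, 501665544, 274903974,
   -2175755569, -2794900218, 23417631310, -53293909838, 56541079532, 53293909838, 23417631310,
   2794900218, -2175755569, -274903974, 501665544, 229763863, -12958887, -35728905, -750208,
   4613750, -1288669, -86564, 955402, 499875, -35583, -107876, -10741, 24643, 9155, -2017, -1801,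
   103, 313, 4, -42]

/-- Coefficients, from frequency `-16` to `16`, of a weight that is a strict subsolution of the
linearized equation. -/
def weightCoeffs : List GaussRat :=
  List.map (fun p : ℤ × ℤ => ⟨mkRat p.1 100000000, mkRat p.2 100000000⟩)
  [(105, 737), (0, 0), (-838, -956), (0, 0), (4569, 1653), (0, 0), (-45456, -10106), (0, 0),
   (127631, 295006), (0, 0), (-311204, -101076), (0, 0), (1008528, -378341), (0, 0),
   (-8313540, 5906101), (0, 0), (101038802, 0), (0, 0), (-8313540, -5906101), (0, 0),
   (1008528, 378341), (0, 0), (-311204, 101076), (0, 0), (127631, -295006), (0, 0),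
   (-45456, 10106), (0, 0), (4569, -1653), (0, 0), (-838, 956), (0, 0), (105, -737)]

/-- A Gaussian rational approximating `exp (2 π i ω)`. -/
def rotApprox : GaussRat := ⟨mkRat (-7373688780) 10000000000, mkRat (-6754902942) 10000000000⟩

/-- Gaussian rationals approximating `exp (2 π i k ω)`. -/
def rotApproxPow : ℤ → GaussRat
  | Int.ofNat n => rotApprox.npow n
  | Int.negSucc n => rotApprox.conj.npow (n + 1)

/-- The approximate torus, as an entire function of the angle. -/
noncomputable def approxTorus : ℂ → ℂ := trigEval torusCoeffs (-17)

/-- Coefficients, from frequency `-43`, of the error in the differential equation for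
`exp (i A)`. -/
def expDefect : List GaussRat :=
  add (pad 17 (freq (-26) expCoeffs))
    (smul ⟨0, -1⟩ (mul (freq (-17) torusCoeffs) expCoeffs))

/-- Coefficients, from frequency `-26`, of the error in the equation of an invariant torus. -/
def torusDefect : List GaussRat :=
  add (pad 9 (add (twist rotApproxPow (-17) torusCoeffs)
      (add (twist (fun k => rotApproxPow (-k)) (-17) torusCoeffs) (smul ⟨-2, 0⟩ torusCoeffs))))
    (add (smul ⟨0, 13 / 20⟩ (add expCoeffs (smul ⟨-1, 0⟩ expCoeffs.reverse)))
      (pad 25 [⟨0, 3.14159265⟩, ⟨0, 0⟩, ⟨0, -3.14159265⟩]))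

/-- Coefficients, from frequency `-42`, of the error in the eigenvalue equation for the weight. -/
def weightDefect : List GaussRat :=
  add (smul ⟨13 / 20, 0⟩ (mul (add expCoeffs expCoeffs.reverse) weightCoeffs))
    (pad 26 (add (smul ⟨2 - 0.000192, 0⟩ weightCoeffs)
      (add (smul ⟨-2.23714, 0⟩ (twist rotApproxPow (-16) weightCoeffs))
        (smul ⟨-1 / 2.23714, 0⟩ (twist (fun k => rotApproxPow (-k)) (-16) weightCoeffs)))))

lemma size_torusCoeffs : TrigList.size torusCoeffs ≤ 1.5276 := by decide +kernel

lemma size_freq_torusCoeffs : TrigList.size (freq (-17) torusCoeffs) ≤ 2 := by decide +kernel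

lemma size_freq_weightCoeffs : TrigList.size (freq (-16) weightCoeffs) ≤ 2 := by decide +kernel

lemma torusCoeffs_reverse : torusCoeffs.reverse = smul ⟨-1, 0⟩ torusCoeffs := by decide +kernel

lemma torusCoeffs_conj : torusCoeffs.map GaussRat.conj = smul ⟨-1, 0⟩ torusCoeffs := by
  decide +kernel

lemma sum_expCoeffs :
    (GaussRat.add ⟨-1, 0⟩ (TrigList.sum expCoeffs)).size ≤ 0.00000001 := by decide +kernel

lemma size_expDefect : TrigList.size expDefect ≤ 0.00000002 := by decide +kernel

lemma size_torusDefect : TrigList.size torusDefect ≤ 0.000001 := by decide +kernel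

lemma size_weightCoeffs : TrigList.size weightCoeffs ≤ 1.4 := by decide +kernel

lemma size_weightCoeffs_sub :
    TrigList.size (add (pad 16 [⟨-1, 0⟩]) weightCoeffs) ≤ 0.35 := by decide +kernel

lemma size_weightDefect : TrigList.size weightDefect ≤ 0.000015 := by decide +kernel

lemma norm_exp_I_mul_sub_le (x y : ℝ) :
    ‖Complex.exp (Complex.I * x) - Complex.exp (Complex.I * y)‖ ≤ |x - y| := by
  have h : Complex.exp (Complex.I * x) - Complex.exp (Complex.I * y)
      = Complex.exp (Complex.I * y) * (Complex.exp (Complex.I * ((x - y : ℝ) : ℂ)) - 1) := by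
    rw [mul_sub, ← Complex.exp_add, mul_one]
    congr 2
    push_cast; ring
  rw [h, norm_mul, mul_comm Complex.I (y : ℂ), Complex.norm_exp_ofReal_mul_I, one_mul]
  exact Real.norm_exp_I_mul_ofReal_sub_one_le

lemma golden_angle_bound {ω : ℝ} (hω : ω = (Real.sqrt 5 - 1) / 2) :
    |2 * Real.pi * ω - Real.pi - 0.7416294239| ≤ 0.000000001 := by
  have h1 : (2.23606797749 : ℝ) < Real.sqrt 5 := Real.lt_sqrt_of_sq_lt (by norm_num)
  have h2 : Real.sqrt 5 < 2.2360679775 := (Real.sqrt_lt' (by norm_num)).2 (by norm_num)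
  have h3 := Real.pi_gt_d20
  have h4 := Real.pi_lt_d20
  have h5 : 2 * Real.pi * ω - Real.pi = Real.pi * (Real.sqrt 5 - 2) := by rw [hω]; ring
  rw [h5, abs_le]
  constructor <;> nlinarith

lemma norm_exp_sub_rotApprox_le {ω : ℝ} (hω : ω = (Real.sqrt 5 - 1) / 2) :
    ‖Complex.exp (Complex.I * ((2 * Real.pi * ω : ℝ) : ℂ)) - rotApprox.toC‖ ≤ 0.00000001 := by
  set β : ℝ := 2 * Real.pi * ω - Real.pi with hβ
  have hexp : Complex.exp (Complex.I * ((2 * Real.pi * ω : ℝ) : ℂ))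
      = -Complex.exp (Complex.I * (β : ℂ)) := by
    have : Complex.I * ((2 * Real.pi * ω : ℝ) : ℂ)
        = Complex.I * (β : ℂ) + Real.pi * Complex.I := by rw [hβ]; push_cast; ring
    rw [this, Complex.exp_add, Complex.exp_pi_mul_I]; ring
  have h1 := (norm_exp_I_mul_sub_le β 0.7416294239).trans (golden_angle_bound hω)
  have hnorm : ‖Complex.I * ((0.7416294239 : ℝ) : ℂ)‖ = 0.7416294239 := by
    rw [norm_mul, Complex.norm_I, one_mul, Complex.norm_real, Real.norm_eq_abs]
    norm_num
  have h2 := Complex.exp_bound (x := Complex.I * ((0.7416294239 : ℝ) : ℂ))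
    (by rw [hnorm]; norm_num) (n := 12) (by norm_num)
  rw [hnorm] at h2
  have h3 : ‖∑ m ∈ Finset.range 12, (Complex.I * ((0.7416294239 : ℝ) : ℂ)) ^ m / m.factorial
      + rotApprox.toC‖ ≤ 0.000000001 := by
    have I3 : Complex.I ^ 3 = -Complex.I := Complex.I_pow_three
    have I4 : Complex.I ^ 4 = 1 := Complex.I_pow_four
    have I5 : Complex.I ^ 5 = Complex.I := by rw [pow_succ, I4, one_mul]
    have I6 : Complex.I ^ 6 = -1 := by rw [pow_succ, I5, Complex.I_mul_I]
    have I7 : Complex.I ^ 7 = -Complex.I := by rw [pow_succ, I6, neg_one_mul]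
    have I8 : Complex.I ^ 8 = 1 := by rw [pow_succ, I7, neg_mul, Complex.I_mul_I, neg_neg]
    have I9 : Complex.I ^ 9 = Complex.I := by rw [pow_succ, I8, one_mul]
    have I10 : Complex.I ^ 10 = -1 := by rw [pow_succ, I9, Complex.I_mul_I]
    have I11 : Complex.I ^ 11 = -Complex.I := by rw [pow_succ, I10, neg_one_mul]
    refine (Complex.norm_le_abs_re_add_abs_im _).trans ?_
    simp only [Finset.sum_range_succ, Finset.sum_range_zero, mul_pow, I3, I4, I5, I6, I7, I8, I9,
      I10, I11, Complex.I_sq, pow_zero, pow_one, GaussRat.toC, rotApprox, Nat.factorial,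
      Rat.mkRat_eq_div]
    simp only [← Complex.ofReal_pow, Complex.add_re, Complex.add_im, Complex.mul_re, Complex.mul_im,
      Complex.div_natCast_re, Complex.div_natCast_im, Complex.ofReal_re, Complex.ofReal_im,
      Complex.I_re, Complex.I_im, Complex.neg_re, Complex.neg_im, Complex.one_re, Complex.one_im,
      ← Complex.ofReal_ratCast, Complex.zero_re, Complex.zero_im]
    norm_num [abs_le]
  have hdecomp : Complex.exp (Complex.I * ((2 * Real.pi * ω : ℝ) : ℂ)) - rotApprox.toC
      = -(Complex.exp (Complex.I * (β : ℂ))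
            - Complex.exp (Complex.I * ((0.7416294239 : ℝ) : ℂ)))
        - (Complex.exp (Complex.I * ((0.7416294239 : ℝ) : ℂ))
            - ∑ m ∈ Finset.range 12, (Complex.I * ((0.7416294239 : ℝ) : ℂ)) ^ m / m.factorial)
        - (∑ m ∈ Finset.range 12, (Complex.I * ((0.7416294239 : ℝ) : ℂ)) ^ m / m.factorial
            + rotApprox.toC) := by
    rw [hexp]; ring
  rw [hdecomp]
  refine (norm_sub_le _ _).trans ((add_le_add ((norm_sub_le _ _).trans
    (add_le_add ((norm_neg _).le.trans h1) h2)) h3).trans ?_)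
  norm_num [Nat.factorial]

lemma norm_pow_sub_pow_le {a b : ℂ} (ha : ‖a‖ ≤ 1) (hb : ‖b‖ ≤ 1) (n : ℕ) :
    ‖a ^ n - b ^ n‖ ≤ n * ‖a - b‖ := by
  induction n with
  | zero => simp
  | succ n ih =>
    have h : a ^ (n + 1) - b ^ (n + 1) = a ^ n * (a - b) + (a ^ n - b ^ n) * b := by ring
    rw [h]
    push_cast
    refine (norm_add_le _ _).trans ?_
    rw [norm_mul, norm_mul, norm_pow, add_mul, one_mul, add_comm]
    refine add_le_add ?_ ?_
    · exact (mul_le_of_le_one_right (norm_nonneg _) hb).trans ih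
    · exact mul_le_of_le_one_left (norm_nonneg _) (pow_le_one₀ (norm_nonneg _) ha)

lemma norm_rotApprox_le : ‖rotApprox.toC‖ ≤ 1 := by
  rw [← sq_le_one_iff₀ (norm_nonneg _), ← Complex.normSq_eq_norm_sq]
  simp only [GaussRat.toC, rotApprox, Rat.mkRat_eq_div, Complex.normSq_apply,
    ← Complex.ofReal_ratCast, Complex.add_re, Complex.add_im, Complex.mul_re, Complex.mul_im,
    Complex.ofReal_re, Complex.ofReal_im, Complex.I_re, Complex.I_im]
  norm_num

lemma norm_exp_sub_rotApproxPow_le {ω : ℝ} (hω : ω = (Real.sqrt 5 - 1) / 2) (k : ℤ) :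
    ‖Complex.exp (Complex.I * k * ((2 * Real.pi * ω : ℝ) : ℂ)) - (rotApproxPow k).toC‖
      ≤ |(k : ℝ)| * 0.00000001 := by
  set z := Complex.exp (Complex.I * ((2 * Real.pi * ω : ℝ) : ℂ)) with hz
  have hz1 : ‖z‖ ≤ 1 := by rw [hz, mul_comm, Complex.norm_exp_ofReal_mul_I]
  have key : ∀ n : ℕ, ‖z ^ n - (rotApprox.npow n).toC‖ ≤ n * 0.00000001 := by
    intro n
    rw [GaussRat.toC_npow]
    exact (norm_pow_sub_pow_le hz1 norm_rotApprox_le n).trans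
      (mul_le_mul_of_nonneg_left (norm_exp_sub_rotApprox_le hω) n.cast_nonneg)
  cases k with
  | ofNat n =>
    have h := key n
    rw [hz, ← Complex.exp_nat_mul] at h
    simp only [rotApproxPow, Int.ofNat_eq_natCast, Int.cast_natCast, Nat.abs_cast]
    convert h using 4
    ring
  | negSucc n =>
    have h := key (n + 1)
    rw [← Complex.norm_conj, map_sub, GaussRat.toC_npow, hz, ← Complex.exp_nat_mul,
      ← Complex.exp_conj] at h
    simp only [rotApproxPow, GaussRat.toC_npow, GaussRat.toC_conj, Int.cast_negSucc, abs_neg,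
      Nat.abs_cast]
    convert h using 4
    · simp only [map_mul, map_natCast, Complex.conj_I, Complex.conj_ofReal]
      push_cast; ring
    · rw [map_pow]

lemma approxTorus_neg (x : ℂ) : approxTorus (-x) = -approxTorus x := by
  have hlen : torusCoeffs.length = 35 := by decide +kernel
  simp only [approxTorus]
  rw [trigEval_neg, torusCoeffs_reverse, trigEval_smul, hlen]
  norm_num [GaussRat.toC]

lemma conj_approxTorus (x : ℝ) : (starRingEnd ℂ) (approxTorus x) = approxTorus x := by
  have h : (starRingEnd ℂ) (approxTorus x) = -approxTorus (-(x : ℂ)) := by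
    simp only [approxTorus]
    rw [conj_trigEval, torusCoeffs_conj, trigEval_smul, Complex.conj_ofReal]
    simp [GaussRat.toC]
  rw [h, approxTorus_neg, neg_neg]

lemma approxTorus_periodic : Function.Periodic approxTorus (2 * Real.pi) :=
  trigEval_periodic _ _

lemma differentiable_approxTorus : Differentiable ℂ approxTorus := fun x =>
  (hasDerivAt_trigEval _ _ x).differentiableAt

lemma norm_approxTorus_le (x : ℝ) : ‖approxTorus x‖ ≤ 1.5276 := by
  have := norm_trigEval_le_of_size_le size_torusCoeffs (-17) x
  norm_num at this ⊢
  exact this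

/-- The trigonometric polynomial with coefficients `expCoeffs` approximates `exp (i A)`. -/
lemma norm_exp_approxTorus_sub_le (x : ℝ) :
    ‖Complex.exp (Complex.I * approxTorus x) - trigEval expCoeffs (-26) x‖ ≤ 0.0000001 := by
  have norm_unit : ∀ y : ℝ, ‖Complex.exp (-(Complex.I * approxTorus y))‖ = 1 := by
    intro y
    obtain ⟨r, hr⟩ := Complex.conj_eq_iff_real.1 (conj_approxTorus y)
    rw [hr, show -(Complex.I * (r : ℂ)) = ((-r : ℝ) : ℂ) * Complex.I by push_cast; ring,
      Complex.norm_exp_ofReal_mul_I]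
  let G : ℂ → ℂ := fun y => trigEval expCoeffs (-26) y * Complex.exp (-(Complex.I * approxTorus y))
  have hG : ∀ y : ℝ, HasDerivAt (fun y : ℝ => G y)
      (Complex.I * trigEval expDefect (-43) y * Complex.exp (-(Complex.I * approxTorus y))) y := by
    intro y
    have h1 := hasDerivAt_trigEval expCoeffs (-26) (y : ℂ)
    have h2 := ((hasDerivAt_trigEval torusCoeffs (-17) (y : ℂ)).const_mul Complex.I).neg.cexp
    refine ((h1.mul h2).comp_ofReal).congr_deriv ?_
    have h3 : trigEval expDefect (-43) (y : ℂ)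
        = trigEval (freq (-26) expCoeffs) (-26) y
          - Complex.I * (trigEval (freq (-17) torusCoeffs) (-17) y
              * trigEval expCoeffs (-26) y) := by
      rw [expDefect, trigEval_add, trigEval_smul, ← trigEval_mul,
        ← trigEval_pad 17 (freq (-26) expCoeffs) (-26)]
      norm_num [GaussRat.toC]
      ring
    rw [h3]
    simp only [approxTorus, Pi.neg_apply]
    ring
  have hbound : ∀ y ∈ Set.Icc (-Real.pi) Real.pi, ‖G (y : ℝ) - 1‖ ≤ 0.0000001 := by
    intro y hy
    have h0 : ‖G ((0 : ℝ) : ℂ) - 1‖ ≤ 0.00000001 := by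
      have hA : approxTorus 0 = 0 := by
        have := approxTorus_neg 0
        rw [neg_zero] at this
        exact self_eq_neg.1 this
      have := (GaussRat.norm_toC_le _).trans (Rat.cast_le (K := ℝ).2 sum_expCoeffs)
      rw [GaussRat.toC_add, ← trigEval_at_zero _ (-26)] at this
      simp only [G, Complex.ofReal_zero, hA, mul_zero, neg_zero, Complex.exp_zero, mul_one]
      norm_num [GaussRat.toC] at this ⊢
      rwa [sub_eq_neg_add]
    have h1 : ‖G (y : ℝ) - G ((0 : ℝ) : ℂ)‖ ≤ 0.00000002 * ‖y - 0‖ := by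
      refine Convex.norm_image_sub_le_of_norm_hasDerivWithin_le (𝕜 := ℝ) (f := fun y : ℝ => G y)
        (s := Set.univ) (fun t _ => (hG t).hasDerivWithinAt) (fun t _ => ?_) convex_univ
        (Set.mem_univ _) (Set.mem_univ _)
      rw [norm_mul, norm_mul, Complex.norm_I, one_mul, norm_unit, mul_one]
      have := norm_trigEval_le_of_size_le size_expDefect (-43) t
      norm_num at this ⊢
      exact this
    have h2 : ‖y - 0‖ ≤ 4 := by
      rw [sub_zero, Real.norm_eq_abs, abs_le]
      constructor <;> linarith [hy.1, hy.2, Real.pi_le_four]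
    calc ‖G (y : ℝ) - 1‖ = ‖(G (y : ℝ) - G ((0 : ℝ) : ℂ)) + (G ((0 : ℝ) : ℂ) - 1)‖ := by
          rw [sub_add_sub_cancel]
      _ ≤ _ := norm_add_le _ _
      _ ≤ 0.0000001 := by norm_num at h0 h1 h2 ⊢; linarith
  have hper : Function.Periodic (fun y : ℝ => ‖G (y : ℝ) - 1‖) (2 * Real.pi) := by
    intro y
    have h1 := trigEval_periodic expCoeffs (-26) y
    have h2 := approxTorus_periodic y
    simp only [G]
    push_cast
    rw [h1, h2]
  obtain ⟨y, hy, hxy⟩ := hper.exists_mem_Ico Real.two_pi_pos x (-Real.pi)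
  have hfin : ‖G (x : ℝ) - 1‖ ≤ 0.0000001 := by
    have := hbound y ⟨hy.1, by linarith [hy.2]⟩
    exact hxy.le.trans this
  have hfac : Complex.exp (Complex.I * approxTorus x) - trigEval expCoeffs (-26) x
      = -((G (x : ℝ) - 1) * Complex.exp (Complex.I * approxTorus x)) := by
    simp only [G]
    rw [sub_mul, mul_assoc, ← Complex.exp_add, neg_add_cancel, Complex.exp_zero]
    ring
  have hunit : ‖Complex.exp (Complex.I * approxTorus x)‖ = 1 := by
    have := norm_unit (-x)
    rwa [Complex.ofReal_neg, approxTorus_neg, mul_neg, neg_neg] at this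
  rwa [hfac, norm_neg, norm_mul, hunit, mul_one]

lemma norm_exp_neg_approxTorus_sub_le (x : ℝ) :
    ‖Complex.exp (-(Complex.I * approxTorus x)) - trigEval expCoeffs.reverse (-26) x‖
      ≤ 0.0000001 := by
  have hlen : expCoeffs.length = 53 := by decide +kernel
  have h := norm_exp_approxTorus_sub_le (-x)
  rw [Complex.ofReal_neg, approxTorus_neg, trigEval_neg, hlen, mul_neg] at h
  norm_num at h ⊢
  exact h

lemma norm_trigEval_add_sub_twist_le {ω : ℝ} (hω : ω = (Real.sqrt 5 - 1) / 2)
    {l : List GaussRat} {k : ℤ} (hl : TrigList.size (freq k l) ≤ 2) (x : ℝ) :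
    ‖trigEval l k (x + (2 * Real.pi * ω : ℝ)) - trigEval (twist rotApproxPow k l) k x‖
      ≤ 0.00000002 := by
  refine (norm_trigEval_translate_sub_le (norm_exp_sub_rotApproxPow_le hω) l k x).trans ?_
  have : (TrigList.size (freq k l) : ℝ) ≤ 2 := by exact_mod_cast hl
  linarith

lemma norm_trigEval_sub_sub_twist_le {ω : ℝ} (hω : ω = (Real.sqrt 5 - 1) / 2)
    {l : List GaussRat} {k : ℤ} (hl : TrigList.size (freq k l) ≤ 2) (x : ℝ) :
    ‖trigEval l k (x - (2 * Real.pi * ω : ℝ))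
      - trigEval (twist (fun j => rotApproxPow (-j)) k l) k x‖ ≤ 0.00000002 := by
  have h := norm_trigEval_translate_sub_le (s := -(2 * Real.pi * ω)) (τ := 0.00000001)
    (c := fun j => rotApproxPow (-j)) (fun j => ?_) l k x
  · rw [Complex.ofReal_neg, ← sub_eq_add_neg] at h
    refine h.trans ?_
    have : (TrigList.size (freq k l) : ℝ) ≤ 2 := by exact_mod_cast hl
    linarith
  · have h := norm_exp_sub_rotApproxPow_le hω (-j)
    rw [Int.cast_neg, Int.cast_neg, abs_neg] at h
    convert h using 4
    push_cast; ring

/-- The approximate torus almost satisfies the invariance equation. -/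
lemma norm_torus_residual_le {ω : ℝ} (hω : ω = (Real.sqrt 5 - 1) / 2) (x : ℝ) :
    ‖approxTorus (x + (2 * Real.pi * ω : ℝ)) + approxTorus (x - (2 * Real.pi * ω : ℝ))
      - 2 * approxTorus x - 1.3 * Complex.sin (approxTorus x) + 2 * Real.pi * Complex.sin x‖
      ≤ 0.000002 := by
  have h1 := norm_trigEval_add_sub_twist_le hω size_freq_torusCoeffs x
  have h2 := norm_trigEval_sub_sub_twist_le hω size_freq_torusCoeffs x
  have h3 := norm_exp_approxTorus_sub_le x
  have h4 := norm_exp_neg_approxTorus_sub_le x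
  have h5 := norm_trigEval_le_of_size_le size_torusDefect (-26) x
  have h6 : ‖((Real.pi - 3.14159265 : ℝ) : ℂ)‖ ≤ 0.00000001 := by
    rw [Complex.norm_real, Real.norm_eq_abs, abs_le]
    constructor <;> linarith [Real.pi_gt_d20, Real.pi_lt_d20]
  have h7 : ‖Complex.sin x‖ ≤ 1 := by
    rw [← Complex.ofReal_sin, Complex.norm_real]
    exact Real.abs_sin_le_one x
  set Y := trigEval expCoeffs (-26) x
  set Y' := trigEval expCoeffs.reverse (-26) x
  set B := trigEval (twist rotApproxPow (-17) torusCoeffs) (-17) x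
  set B' := trigEval (twist (fun j => rotApproxPow (-j)) (-17) torusCoeffs) (-17) x
  have hdef : trigEval torusDefect (-26) x = B + B' - 2 * approxTorus x
      + (13 / 20) * Complex.I * (Y - Y') + 2 * 3.14159265 * Complex.sin x := by
    have e1 := fun l => trigEval_pad 9 l (-17) (x : ℂ)
    have e2 := fun l => trigEval_pad 25 l (-1) (x : ℂ)
    norm_num at e1 e2
    rw [torusDefect, trigEval_add, e1, trigEval_add, trigEval_add, trigEval_add, e2,
      trigEval_smul, trigEval_smul, trigEval_add, trigEval_smul]
    simp only [trigEval, GaussRat.toC, Complex.sin]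
    have e3 : Complex.exp (Complex.I * ((-1 : ℤ) : ℂ) * x) = Complex.exp (-x * Complex.I) := by
      congr 1; push_cast; ring
    have e4 : Complex.exp (Complex.I * ((-1 + 1 + 1 : ℤ) : ℂ) * x)
        = Complex.exp (x * Complex.I) := by
      congr 1; push_cast; ring
    rw [e3, e4]
    simp only [B, B', Y, Y', approxTorus]
    push_cast
    ring
  have hsin : Complex.sin (approxTorus x) = (Complex.exp (-(Complex.I * approxTorus x))
      - Complex.exp (Complex.I * approxTorus x)) * Complex.I / 2 := by
    rw [Complex.sin, neg_mul, mul_comm Complex.I]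
  have hdecomp : approxTorus (x + (2 * Real.pi * ω : ℝ)) + approxTorus (x - (2 * Real.pi * ω : ℝ))
      - 2 * approxTorus x - 1.3 * Complex.sin (approxTorus x) + 2 * Real.pi * Complex.sin x
      = (approxTorus (x + (2 * Real.pi * ω : ℝ)) - B)
        + (approxTorus (x - (2 * Real.pi * ω : ℝ)) - B')
        + ((13 / 20) * Complex.I) * (Complex.exp (Complex.I * approxTorus x) - Y)
        + (-(13 / 20) * Complex.I) * (Complex.exp (-(Complex.I * approxTorus x)) - Y')
        + (2 * ((Real.pi - 3.14159265 : ℝ) : ℂ)) * Complex.sin x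
        + trigEval torusDefect (-26) x := by
    rw [hdef, hsin]; push_cast; ring
  rw [hdecomp]
  refine (norm_add_le _ _).trans ((add_le_add ((norm_add_le _ _).trans (add_le_add
    ((norm_add_le _ _).trans (add_le_add ((norm_add_le _ _).trans (add_le_add
      ((norm_add_le _ _).trans (add_le_add h1 h2)) (norm_mul_le _ _))) (norm_mul_le _ _)))
      (norm_mul_le _ _))) h5).trans ?_)
  have n1 : ‖(13 / 20 : ℂ) * Complex.I‖ = 13 / 20 := by
    rw [norm_mul, Complex.norm_I]; norm_num
  have n2 : ‖-(13 / 20 : ℂ) * Complex.I‖ = 13 / 20 := by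
    rw [norm_mul, norm_neg, Complex.norm_I]; norm_num
  have n3 : ‖2 * ((Real.pi - 3.14159265 : ℝ) : ℂ)‖ * ‖Complex.sin (x : ℂ)‖ ≤ 0.00000002 := by
    rw [norm_mul, Complex.norm_ofNat]
    nlinarith [norm_nonneg ((Real.pi - 3.14159265 : ℝ) : ℂ), norm_nonneg (Complex.sin (x : ℂ))]
  rw [n1, n2]
  norm_num at h3 h4 n3 ⊢
  linarith

/-- A positive weight that is a subsolution of the linearized equation. -/
noncomputable def weight (x : ℝ) : ℝ := (trigEval weightCoeffs (-16) x).re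

lemma continuous_weight : Continuous weight := by
  have : Continuous (trigEval weightCoeffs (-16)) :=
    continuous_iff_continuousAt.2 fun x => (hasDerivAt_trigEval _ _ x).continuousAt
  exact Complex.continuous_re.comp (this.comp Complex.continuous_ofReal)

lemma weight_periodic : Function.Periodic weight (2 * Real.pi) := by
  intro x
  have := trigEval_periodic weightCoeffs (-16) x
  simp only [weight]
  push_cast
  rw [this]

lemma weight_ge (x : ℝ) : 0.65 ≤ weight x := by
  have h := norm_trigEval_le_of_size_le size_weightCoeffs_sub (-16) x
  have e1 := fun l => trigEval_pad 16 l 0 (x : ℂ)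
  norm_num at e1
  rw [trigEval_add, e1] at h
  have h1 := (Complex.abs_re_le_norm _).trans h
  norm_num [trigEval, GaussRat.toC] at h1
  rw [abs_le] at h1
  simp only [weight]
  norm_num
  linarith [h1.1]

lemma weight_subsolution {ω : ℝ} (hω : ω = (Real.sqrt 5 - 1) / 2) (x : ℝ) :
    2.23714 * weight (x + 2 * Real.pi * ω) + weight (x - 2 * Real.pi * ω) / 2.23714
      ≤ (2 + 1.3 * Real.cos (approxTorus x).re - 1.3 * 0.0001) * weight x := by
  have h1 := norm_trigEval_add_sub_twist_le hω size_freq_weightCoeffs x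
  have h2 := norm_trigEval_sub_sub_twist_le hω size_freq_weightCoeffs x
  have h3 := norm_exp_approxTorus_sub_le x
  have h4 := norm_exp_neg_approxTorus_sub_le x
  have h5 := norm_trigEval_le_of_size_le size_weightDefect (-42) x
  have h6 := norm_trigEval_le_of_size_le size_weightCoeffs (-16) x
  set Y := trigEval expCoeffs (-26) x
  set Y' := trigEval expCoeffs.reverse (-26) x
  set B := trigEval (twist rotApproxPow (-16) weightCoeffs) (-16) x
  set B' := trigEval (twist (fun j => rotApproxPow (-j)) (-16) weightCoeffs) (-16) x
  set H := trigEval weightCoeffs (-16) x with hH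
  set Hp := trigEval weightCoeffs (-16) (x + (2 * Real.pi * ω : ℝ)) with hHp
  set Hm := trigEval weightCoeffs (-16) (x - (2 * Real.pi * ω : ℝ)) with hHm
  have hdef : trigEval weightDefect (-42) x = (13 / 20) * ((Y + Y') * H) + (2 - 0.000192) * H
      - 2.23714 * B - B' / 2.23714 := by
    have e1 := fun l => trigEval_pad 26 l (-16) (x : ℂ)
    have e2 := fun l m => trigEval_mul l m (-26) (-16) (x : ℂ)
    norm_num at e1 e2
    rw [weightDefect, trigEval_add, e1, trigEval_smul, e2, trigEval_add, trigEval_add, trigEval_add,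
      trigEval_smul, trigEval_smul, trigEval_smul]
    simp only [GaussRat.toC]
    push_cast
    simp only [B, B', Y, Y', H]
    ring
  obtain ⟨r, hr⟩ := Complex.conj_eq_iff_real.1 (conj_approxTorus x)
  have hcos : ((Real.cos r : ℝ) : ℂ) = (Complex.exp (Complex.I * approxTorus x)
      + Complex.exp (-(Complex.I * approxTorus x))) / 2 := by
    rw [Complex.ofReal_cos, hr, Complex.cos, neg_mul, mul_comm Complex.I]
  have hdecomp : ((2 + 1.3 * Real.cos r - 0.000192 : ℝ) : ℂ) * H - ((2.23714 : ℝ) : ℂ) * Hp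
      - ((1 / 2.23714 : ℝ) : ℂ) * Hm
      = (13 / 20 * H) * (Complex.exp (Complex.I * approxTorus x) - Y)
        + (13 / 20 * H) * (Complex.exp (-(Complex.I * approxTorus x)) - Y')
        + (-2.23714) * (Hp - B) + (-1 / 2.23714) * (Hm - B') + trigEval weightDefect (-42) x := by
    rw [hdef]; push_cast [hcos]; ring
  have hnorm : ‖((2 + 1.3 * Real.cos r - 0.000192 : ℝ) : ℂ) * H - ((2.23714 : ℝ) : ℂ) * Hp
      - ((1 / 2.23714 : ℝ) : ℂ) * Hm‖ ≤ 0.00002 := by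
    rw [hdecomp]
    refine (norm_add_le _ _).trans ((add_le_add ((norm_add_le _ _).trans (add_le_add
      ((norm_add_le _ _).trans (add_le_add ((norm_add_le _ _).trans (add_le_add (norm_mul_le _ _)
      (norm_mul_le _ _))) (norm_mul_le _ _))) (norm_mul_le _ _))) h5).trans ?_)
    have n1 : ‖(13 / 20 : ℂ) * H‖ ≤ 1 := by
      rw [norm_mul]; norm_num at h6 ⊢; linarith
    have n2 : ‖(-2.23714 : ℂ)‖ ≤ 3 := by norm_num
    have n3 : ‖(-1 / 2.23714 : ℂ)‖ ≤ 1 := by norm_num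
    have m1 := mul_le_mul n1 h3 (norm_nonneg _) zero_le_one
    have m2 := mul_le_mul n1 h4 (norm_nonneg _) zero_le_one
    have m3 := mul_le_mul n2 h1 (norm_nonneg _) zero_le_three
    have m4 := mul_le_mul n3 h2 (norm_nonneg _) zero_le_one
    refine (add_le_add (add_le_add (add_le_add (add_le_add m1 m2) m3) m4) le_rfl).trans ?_
    norm_num
  have hre := (abs_le.1 ((Complex.abs_re_le_norm _).trans hnorm)).1
  simp only [Complex.sub_re, Complex.re_ofReal_mul] at hre
  have hw := weight_ge x
  have e0 : weight x = H.re := rfl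
  have ep : weight (x + 2 * Real.pi * ω) = Hp.re := by simp [weight, hHp]
  have em : weight (x - 2 * Real.pi * ω) = Hm.re := by simp [weight, hHm]
  rw [e0] at hw
  rw [ep, em, e0, hr, Complex.ofReal_re]
  norm_num at hre hw ⊢
  nlinarith

open Filter Topology

/-! ### Holomorphic periodic functions on a strip -/

/-- The horizontal strip of half-width `ρ` about the real axis. -/
def strip (ρ : ℝ) : Set ℂ := {z | |z.im| < ρ}

lemma strip_subset {ρ ρ' : ℝ} (h : ρ ≤ ρ') : strip ρ ⊆ strip ρ' := fun z hz => by
  have hz' : |z.im| < ρ := by simpa [strip] using hz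
  simpa [strip] using hz'.trans_le h

lemma isOpen_strip (ρ : ℝ) : IsOpen (strip ρ) :=
  isOpen_lt (continuous_abs.comp Complex.continuous_im) continuous_const

lemma add_ofReal_mem_strip {ρ : ℝ} {z : ℂ} (hz : z ∈ strip ρ) (s : ℝ) : z + s ∈ strip ρ := by
  simpa [strip] using hz

lemma sub_ofReal_mem_strip {ρ : ℝ} {z : ℂ} (hz : z ∈ strip ρ) (s : ℝ) : z - s ∈ strip ρ := by
  simpa [strip] using hz

lemma ofReal_mem_strip {ρ : ℝ} (hρ : 0 < ρ) (x : ℝ) : (x : ℂ) ∈ strip ρ := by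
  simpa [strip] using hρ

/-- Holomorphic on the strip, `1`-periodic and real on the real axis. -/
structure IsStripFun (ρ : ℝ) (f : ℂ → ℂ) : Prop where
  diff : DifferentiableOn ℂ f (strip ρ)
  periodic : ∀ z ∈ strip ρ, f (z + 1) = f z
  real : ∀ x : ℝ, (f x).im = 0

/-- The contraction principle for holomorphic periodic functions on a strip whose values are
constrained to closed sets. -/
theorem exists_strip_fixedPoint {ρ q C : ℝ} (hρ : 0 < ρ) (hq0 : 0 ≤ q) (hq1 : q < 1)
    {B : ℂ → Set ℂ} (hB : ∀ z, IsClosed (B z)) (T : (ℂ → ℂ) → ℂ → ℂ)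
    (hT : ∀ f, IsStripFun ρ f → (∀ z ∈ strip ρ, f z ∈ B z) →
      IsStripFun ρ (T f) ∧ ∀ z ∈ strip ρ, T f z ∈ B z)
    (hLip : ∀ f g, (∀ z ∈ strip ρ, f z ∈ B z) → (∀ z ∈ strip ρ, g z ∈ B z) →
      ∀ M, (∀ z ∈ strip ρ, ‖f z - g z‖ ≤ M) → ∀ z ∈ strip ρ, ‖T f z - T g z‖ ≤ q * M)
    {f₀ : ℂ → ℂ} (h₀ : IsStripFun ρ f₀) (h₀B : ∀ z ∈ strip ρ, f₀ z ∈ B z)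
    (hC : ∀ z ∈ strip ρ, ‖f₀ z - T f₀ z‖ ≤ C) :
    ∃ f, IsStripFun ρ f ∧ (∀ z ∈ strip ρ, f z ∈ B z) ∧ ∀ z ∈ strip ρ, T f z = f z := by
  let F : ℕ → ℂ → ℂ := fun n => T^[n] f₀
  have hFs : ∀ n, F (n + 1) = T (F n) := fun n => Function.iterate_succ_apply' T n f₀
  have hF : ∀ n, IsStripFun ρ (F n) ∧ ∀ z ∈ strip ρ, F n z ∈ B z := by
    intro n
    induction n with
    | zero => exact ⟨h₀, h₀B⟩
    | succ n ih => rw [hFs]; exact hT _ ih.1 ih.2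
  have hstep : ∀ n, ∀ z ∈ strip ρ, ‖F n z - F (n + 1) z‖ ≤ C * q ^ n := by
    intro n
    induction n with
    | zero => simpa [F] using hC
    | succ n ih =>
      intro z hz
      rw [hFs n, hFs (n + 1)]
      refine (hLip _ _ (hF n).2 (hF (n + 1)).2 _ ih z hz).trans (le_of_eq ?_)
      ring
  have hstep' : ∀ z ∈ strip ρ, ∀ n, dist (F n z) (F (n + 1) z) ≤ C * q ^ n := fun z hz n => by
    rw [dist_eq_norm]; exact hstep n z hz
  have hlim : ∀ z : ℂ, ∃ w, z ∈ strip ρ → Tendsto (fun n => F n z) atTop (𝓝 w) := by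
    intro z
    by_cases hz : z ∈ strip ρ
    · obtain ⟨w, hw⟩ := cauchySeq_tendsto_of_complete
        (cauchySeq_of_le_geometric q C hq1 (hstep' z hz))
      exact ⟨w, fun _ => hw⟩
    · exact ⟨0, fun h => absurd h hz⟩
  choose f hf using hlim
  have hdist : ∀ n, ∀ z ∈ strip ρ, ‖F n z - f z‖ ≤ C * q ^ n / (1 - q) := fun n z hz => by
    rw [← dist_eq_norm]
    exact dist_le_of_le_geometric_of_tendsto q C hq1 (hstep' z hz) (hf z hz) n
  have hpow : Tendsto (fun n : ℕ => C * q ^ n / (1 - q)) atTop (𝓝 0) := by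
    simpa using ((tendsto_pow_atTop_nhds_zero_of_lt_one hq0 hq1).const_mul C).div_const (1 - q)
  have hunif : TendstoUniformlyOn F f atTop (strip ρ) := by
    rw [Metric.tendstoUniformlyOn_iff]
    intro ε hε
    filter_upwards [hpow.eventually_lt_const hε] with n hn z hz
    rw [dist_comm, dist_eq_norm]
    exact (hdist n z hz).trans_lt hn
  have hfB : ∀ z ∈ strip ρ, f z ∈ B z := fun z hz =>
    (hB z).mem_of_tendsto (hf z hz) (Eventually.of_forall fun n => (hF n).2 z hz)
  refine ⟨f, ⟨?_, ?_, ?_⟩, hfB, ?_⟩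
  · exact hunif.tendstoLocallyUniformlyOn.differentiableOn
      (Eventually.of_forall fun n => (hF n).1.diff) (isOpen_strip ρ)
  · intro z hz
    have hz1 : z + 1 ∈ strip ρ := by simpa using add_ofReal_mem_strip hz 1
    refine tendsto_nhds_unique (hf _ hz1) ((hf z hz).congr fun n => ?_)
    exact ((hF n).1.periodic z hz).symm
  · intro x
    have h := (Complex.continuous_im.tendsto _).comp (hf x (ofReal_mem_strip hρ x))
    refine tendsto_nhds_unique h ?_
    refine tendsto_const_nhds.congr fun n => ?_
    exact ((hF n).1.real x).symm
  · intro z hz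
    have h1 : Tendsto (fun n => T (F n) z) atTop (𝓝 (T f z)) := by
      rw [tendsto_iff_norm_sub_tendsto_zero]
      refine squeeze_zero (fun _ => norm_nonneg _)
        (fun n => hLip _ _ (hF n).2 hfB _ (hdist n) z hz) ?_
      simpa using hpow.const_mul q
    have h2 : Tendsto (fun n => T (F n) z) atTop (𝓝 (f z)) := by
      have := (tendsto_add_atTop_iff_nat 1).2 (hf z hz)
      exact this.congr fun n => by rw [hFs]
    exact tendsto_nhds_unique h1 h2

/-- A holomorphic periodic function that satisfies an open bound on the real axis satisfies it on
a strip. -/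
lemma exists_strip_forall_mem {f : ℂ → ℂ} (hf : Continuous f) (hper : Function.Periodic f 1)
    {U : Set ℂ} (hU : IsOpen U) (hfU : ∀ x : ℝ, f x ∈ U) :
    ∃ ρ > 0, ∀ z ∈ strip ρ, f z ∈ U := by
  have hK : IsCompact ((fun x : ℝ => (x : ℂ)) '' Set.Icc (0 : ℝ) 1) :=
    isCompact_Icc.image Complex.continuous_ofReal
  have hsub : ((fun x : ℝ => (x : ℂ)) '' Set.Icc (0 : ℝ) 1) ⊆ f ⁻¹' U := by
    rintro _ ⟨x, -, rfl⟩; exact hfU x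
  obtain ⟨ρ, hρ, hthick⟩ := hK.exists_thickening_subset_open (hU.preimage hf) hsub
  refine ⟨ρ, hρ, fun z hz => ?_⟩
  have hz' : f (z - (⌊z.re⌋ : ℤ)) = f z := by
    simpa using hper.sub_int_mul_eq (x := z) ⌊z.re⌋
  rw [← hz']
  apply hthick
  rw [Metric.mem_thickening_iff]
  refine ⟨((Int.fract z.re : ℝ) : ℂ), ⟨_, ⟨Int.fract_nonneg _, (Int.fract_lt_one _).le⟩, rfl⟩, ?_⟩
  have : z - (⌊z.re⌋ : ℤ) - ((Int.fract z.re : ℝ) : ℂ) = z.im * Complex.I := by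
    apply Complex.ext <;> simp
  rw [dist_eq_norm, this, norm_mul, Complex.norm_I, mul_one, Complex.norm_real]
  exact hz

/-! ### The invariant torus -/

/-- A neighbourhood of the values of the approximate torus. -/
def torusBox : Set ℂ := {v | |v.re| ≤ 1.528 ∧ |v.im| ≤ 0.001}

lemma convex_torusBox : Convex ℝ torusBox := by
  have h : torusBox = Complex.reLm ⁻¹' Set.Icc (-1.528) 1.528 ∩
      Complex.imLm ⁻¹' Set.Icc (-0.001) 0.001 := by
    ext v; simp [torusBox, abs_le]
  rw [h]
  exact ((convex_Icc _ _).linear_preimage _).inter ((convex_Icc _ _).linear_preimage _)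

lemma cos_bounds_of_mem_torusBox {v : ℂ} (hv : v ∈ torusBox) :
    0.0427 ≤ (Complex.cos v).re ∧ (Complex.cos v).re ≤ 1.000001 ∧
      |(Complex.cos v).im| ≤ 0.0015 := by
  obtain ⟨ha, hb⟩ := hv
  have hre : (Complex.cos v).re = Real.cos v.re * Real.cosh v.im := by
    rw [Complex.cos_eq]
    simp [← Complex.ofReal_cos, ← Complex.ofReal_cosh, ← Complex.ofReal_sin, ← Complex.ofReal_sinh]
  have him : (Complex.cos v).im = -(Real.sin v.re * Real.sinh v.im) := by
    rw [Complex.cos_eq]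
    simp [← Complex.ofReal_cos, ← Complex.ofReal_cosh, ← Complex.ofReal_sin, ← Complex.ofReal_sinh]
  have hcosh1 := Real.one_le_cosh v.im
  have hb2 : v.im ^ 2 ≤ 0.000001 := by
    rw [← sq_abs]
    nlinarith [abs_nonneg v.im]
  have hcosh2 : Real.cosh v.im ≤ 1.000001 := by
    refine (Real.cosh_le_exp_half_sq _).trans ?_
    refine (Real.exp_le_exp.2 (by linarith : v.im ^ 2 / 2 ≤ 0.0000005)).trans ?_
    have := Real.exp_bound_div_one_sub_of_interval (x := 0.0000005) (by norm_num) (by norm_num)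
    exact this.trans (by norm_num)
  have hsinh : |Real.sinh v.im| ≤ 0.0015 := by
    apply abs_le_of_sq_le_sq _ (by norm_num)
    have := Real.cosh_sq v.im
    nlinarith
  have hcos : 0.0427 ≤ Real.cos v.re := by
    rw [← Real.cos_abs, ← Real.sin_pi_div_two_sub]
    have hpi := Real.pi_gt_d20
    have h1 : (0.04278 : ℝ) ≤ Real.pi / 2 - |v.re| := by linarith
    have h2 : Real.sin 0.04278 ≤ Real.sin (Real.pi / 2 - |v.re|) :=
      Real.sin_le_sin_of_le_of_le_pi_div_two (by linarith) (by linarith [abs_nonneg v.re]) h1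
    have h3 := Real.sin_gt_sub_cube (x := 0.04278) (by norm_num)
    refine le_trans ?_ h2
    refine le_trans ?_ h3.le
    norm_num
  refine ⟨?_, ?_, ?_⟩
  · rw [hre]; nlinarith
  · rw [hre]; nlinarith [Real.cos_le_one v.re]
  · rw [him, abs_neg, abs_mul]
    nlinarith [Real.abs_sin_le_one v.re, abs_nonneg (Real.sin v.re), abs_nonneg (Real.sinh v.im)]

lemma norm_sub_sin_sub_le {v w : ℂ} (hv : v ∈ torusBox) (hw : w ∈ torusBox) :
    ‖(1.3 * v - 1.3 * Complex.sin v) - (1.3 * w - 1.3 * Complex.sin w)‖ ≤ 1.25 * ‖v - w‖ := by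
  refine convex_torusBox.norm_image_sub_le_of_norm_hasDerivWithin_le (𝕜 := ℂ)
    (f := fun v => 1.3 * v - 1.3 * Complex.sin v) (f' := fun v => 1.3 - 1.3 * Complex.cos v)
    (fun u _ => ?_) (fun u hu => ?_) hw hv
  · have h := ((hasDerivAt_id u).const_mul (1.3 : ℂ)).sub
      ((Complex.hasDerivAt_sin u).const_mul (1.3 : ℂ))
    rw [mul_one] at h
    exact h.hasDerivWithinAt
  · obtain ⟨h1, h2, h3⟩ := cos_bounds_of_mem_torusBox hu
    have hn : ‖1 - Complex.cos u‖ ≤ 0.9573 + 0.0015 := by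
      refine (Complex.norm_le_abs_re_add_abs_im _).trans (add_le_add ?_ ?_)
      · rw [Complex.sub_re, Complex.one_re, abs_le]
        constructor <;> linarith
      · rw [Complex.sub_im, Complex.one_im, zero_sub, abs_neg]
        exact h3
    rw [show (1.3 : ℂ) - 1.3 * Complex.cos u = 1.3 * (1 - Complex.cos u) by ring, norm_mul]
    norm_num at hn ⊢
    linarith

theorem exists_torus {ω : ℝ} (hω : ω = (Real.sqrt 5 - 1) / 2) :
    ∃ ρ > 0, ∃ U : ℂ → ℂ, IsStripFun ρ U ∧ (∀ z ∈ strip ρ, U z ∈ torusBox) ∧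
      (∀ x : ℝ, ‖U x - approxTorus (2 * Real.pi * x)‖ ≤ 0.0001) ∧
      ∀ z ∈ strip ρ, U (z + ω) + U (z - ω) - 2 * U z - 1.3 * Complex.sin (U z)
        + 2 * Real.pi * Complex.sin (2 * Real.pi * z) = 0 := by
  let A : ℂ → ℂ := fun z => approxTorus (2 * Real.pi * z)
  have hAd : Differentiable ℂ A := differentiable_approxTorus.comp (differentiable_id.const_mul _)
  have hAper : Function.Periodic A 1 := fun z => by
    simp only [A]; rw [mul_add, mul_one, approxTorus_periodic]
  have hAreal : ∀ x : ℝ, (A x).im = 0 := fun x => by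
    have := conj_approxTorus (2 * Real.pi * x)
    push_cast at this
    exact Complex.conj_eq_iff_im.1 this
  have hAnorm : ∀ x : ℝ, ‖A x‖ ≤ 1.5276 := fun x => by
    have := norm_approxTorus_le (2 * Real.pi * x)
    push_cast at this
    exact this
  let E : ℂ → ℂ := fun z => A (z + ω) + A (z - ω) - 2 * A z - 1.3 * Complex.sin (A z)
    + 2 * Real.pi * Complex.sin (2 * Real.pi * z)
  have hsinper : ∀ z : ℂ, Complex.sin (2 * Real.pi * (z + 1)) = Complex.sin (2 * Real.pi * z) :=
    fun z => by rw [mul_add, mul_one, Complex.sin_add_two_pi]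
  have hEper : Function.Periodic E 1 := fun z => by
    simp only [E]
    rw [hsinper, hAper z, add_right_comm z 1, hAper, add_sub_right_comm z 1, hAper]
  have hEcont : Continuous E := by
    have := hAd.continuous
    fun_prop
  have hEreal : ∀ x : ℝ, ‖E x‖ ≤ 0.000002 := fun x => by
    have := norm_torus_residual_le hω (2 * Real.pi * x)
    push_cast at this
    simp only [E, A, mul_add, mul_sub]
    exact this
  obtain ⟨ρ₁, hρ₁, h₁⟩ := exists_strip_forall_mem hAd.continuous hAper
    (U := {v | |v.re| < 1.5277} ∩ {v | |v.im| < 0.0001})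
    ((isOpen_lt (continuous_abs.comp Complex.continuous_re) continuous_const).inter
      (isOpen_lt (continuous_abs.comp Complex.continuous_im) continuous_const))
    (fun x => ⟨((Complex.abs_re_le_norm _).trans (hAnorm x)).trans_lt (by norm_num), by
      simp only [Set.mem_ofPred_eq]; rw [hAreal]; norm_num⟩)
  obtain ⟨ρ₂, hρ₂, h₂⟩ := exists_strip_forall_mem hEcont hEper (U := Metric.ball 0 0.000005)
    Metric.isOpen_ball (fun x => by
      rw [mem_ball_zero_iff]; exact (hEreal x).trans_lt (by norm_num))
  set ρ := min ρ₁ ρ₂ with hρdef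
  have hρ : 0 < ρ := lt_min hρ₁ hρ₂
  have hA : ∀ z ∈ strip ρ, |(A z).re| < 1.5277 ∧ |(A z).im| < 0.0001 := fun z hz =>
    h₁ z (strip_subset (min_le_left _ _) hz)
  have hE : ∀ z ∈ strip ρ, ‖E z‖ ≤ 0.000005 := fun z hz =>
    (mem_ball_zero_iff.1 (h₂ z (strip_subset (min_le_right _ _) hz))).le
  have hbox : ∀ z ∈ strip ρ, ∀ v ∈ Metric.closedBall (A z) 0.0001, v ∈ torusBox := by
    intro z hz v hv
    rw [mem_closedBall_iff_norm] at hv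
    have hr := (Complex.abs_re_le_norm _).trans hv
    have hi := (Complex.abs_im_le_norm _).trans hv
    obtain ⟨h3, h4⟩ := hA z hz
    rw [Complex.sub_re, abs_le] at hr
    rw [Complex.sub_im, abs_le] at hi
    rw [abs_lt] at h3 h4
    constructor <;> rw [abs_le] <;> constructor <;> norm_num at * <;> linarith
  let T : (ℂ → ℂ) → ℂ → ℂ := fun f z =>
    (f (z + ω) + f (z - ω) + (1.3 * f z - 1.3 * Complex.sin (f z))
      + 2 * Real.pi * Complex.sin (2 * Real.pi * z)) / 3.3
  have hLip : ∀ f g, (∀ z ∈ strip ρ, f z ∈ Metric.closedBall (A z) 0.0001) →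
      (∀ z ∈ strip ρ, g z ∈ Metric.closedBall (A z) 0.0001) →
      ∀ M, (∀ z ∈ strip ρ, ‖f z - g z‖ ≤ M) →
        ∀ z ∈ strip ρ, ‖T f z - T g z‖ ≤ 3.25 / 3.3 * M := by
    intro f g hf hg M hM z hz
    have e : T f z - T g z = ((f (z + ω) - g (z + ω)) + (f (z - ω) - g (z - ω))
        + ((1.3 * f z - 1.3 * Complex.sin (f z)) - (1.3 * g z - 1.3 * Complex.sin (g z))))
          / 3.3 := by
      simp only [T]; ring
    have h1 := hM _ (add_ofReal_mem_strip hz ω)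
    have h2 := hM _ (sub_ofReal_mem_strip hz ω)
    have h3 := norm_sub_sin_sub_le (hbox z hz _ (hf z hz)) (hbox z hz _ (hg z hz))
    have h4 := hM z hz
    have h5 := norm_add₃_le (a := f (z + ω) - g (z + ω)) (b := f (z - ω) - g (z - ω))
      (c := (1.3 * f z - 1.3 * Complex.sin (f z)) - (1.3 * g z - 1.3 * Complex.sin (g z)))
    rw [e, norm_div, show ‖(3.3 : ℂ)‖ = 3.3 by norm_num, div_mul_eq_mul_div]
    refine div_le_div_of_nonneg_right ?_ (by norm_num)
    linarith
  have hTA : ∀ z ∈ strip ρ, ‖A z - T A z‖ ≤ 0.000005 / 3.3 := by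
    intro z hz
    have e : A z - T A z = -(E z) / 3.3 := by simp only [T, E]; ring
    rw [e, norm_div, norm_neg, show ‖(3.3 : ℂ)‖ = 3.3 by norm_num]
    exact div_le_div_of_nonneg_right (hE z hz) (by norm_num)
  have hAball : ∀ z ∈ strip ρ, A z ∈ Metric.closedBall (A z) 0.0001 := fun z _ =>
    Metric.mem_closedBall_self (by norm_num)
  have hT : ∀ f, IsStripFun ρ f → (∀ z ∈ strip ρ, f z ∈ Metric.closedBall (A z) 0.0001) →
      IsStripFun ρ (T f) ∧ ∀ z ∈ strip ρ, T f z ∈ Metric.closedBall (A z) 0.0001 := by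
    intro f hf hfB
    refine ⟨⟨?_, ?_, ?_⟩, ?_⟩
    · have hp : DifferentiableOn ℂ (fun z => f (z + ω)) (strip ρ) :=
        hf.diff.comp (by fun_prop) fun z hz => add_ofReal_mem_strip hz ω
      have hm : DifferentiableOn ℂ (fun z => f (z - ω)) (strip ρ) :=
        hf.diff.comp (by fun_prop) fun z hz => sub_ofReal_mem_strip hz ω
      have hs : DifferentiableOn ℂ (fun z : ℂ => 2 * Real.pi * Complex.sin (2 * Real.pi * z))
        (strip ρ) := by fun_prop
      exact (((hp.add hm).add ((hf.diff.const_mul _).sub (hf.diff.csin.const_mul _))).add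
        hs).div_const _
    · intro z hz
      simp only [T]
      rw [hsinper, hf.periodic z hz, add_right_comm z 1,
        hf.periodic _ (add_ofReal_mem_strip hz ω), add_sub_right_comm z 1,
        hf.periodic _ (sub_ofReal_mem_strip hz ω)]
    · intro x
      have hreal : ∀ y : ℝ, ((f y).re : ℂ) = f y := fun y => by
        apply Complex.ext <;> simp [hf.real y]
      have e : T f x = ((((f (x + ω : ℝ)).re + (f (x - ω : ℝ)).re
          + (1.3 * (f x).re - 1.3 * Real.sin (f x).re)
          + 2 * Real.pi * Real.sin (2 * Real.pi * x)) / 3.3 : ℝ) : ℂ) := by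
        simp only [T]
        push_cast
        rw [hreal, ← Complex.ofReal_add, ← Complex.ofReal_sub, hreal, hreal]
      rw [e, Complex.ofReal_im]
    · intro z hz
      rw [mem_closedBall_iff_norm]
      have h1 := hLip f A hfB hAball 0.0001 (fun z hz => mem_closedBall_iff_norm.1 (hfB z hz)) z hz
      have h2 := hTA z hz
      rw [norm_sub_rev] at h2
      have h3 := norm_sub_le_norm_sub_add_norm_sub (T f z) (T A z) (A z)
      norm_num at h1 h2 ⊢
      linarith
  obtain ⟨U, hU, hUB, hUT⟩ := exists_strip_fixedPoint hρ (by norm_num : (0 : ℝ) ≤ 3.25 / 3.3)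
    (by norm_num) (fun _ => Metric.isClosed_closedBall) T hT hLip
    (f₀ := A) ⟨hAd.differentiableOn, fun z _ => hAper z, hAreal⟩ hAball hTA
  refine ⟨ρ, hρ, U, hU, fun z hz => hbox z hz _ (hUB z hz), fun x => ?_, fun z hz => ?_⟩
  · exact mem_closedBall_iff_norm.1 (hUB x (ofReal_mem_strip hρ x))
  · have h := hUT z hz
    simp only [T] at h
    rw [div_eq_iff (by norm_num)] at h
    linear_combination h

/-! ### The Riccati equation -/

lemma norm_inv_le_of_re {w : ℂ} (hw : 1.2 ≤ w.re) : ‖w⁻¹‖ ≤ 1 / 1.2 := by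
  rw [norm_inv, one_div]
  exact inv_anti₀ (by norm_num) (hw.trans ((le_abs_self _).trans (Complex.abs_re_le_norm w)))

lemma ne_zero_of_re {w : ℂ} (hw : 1.2 ≤ w.re) : w ≠ 0 := fun h => by
  rw [h, Complex.zero_re] at hw; norm_num at hw

lemma norm_inv_sub_inv_le {v w : ℂ} (hv : 1.2 ≤ v.re) (hw : 1.2 ≤ w.re) :
    ‖v⁻¹ - w⁻¹‖ ≤ 1 / 1.44 * ‖v - w‖ := by
  have e : v⁻¹ - w⁻¹ = v⁻¹ * w⁻¹ * (w - v) := by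
    have := ne_zero_of_re hv
    have := ne_zero_of_re hw
    field_simp
  rw [e, norm_mul, norm_mul, norm_sub_rev v w]
  refine mul_le_mul_of_nonneg_right ?_ (norm_nonneg _)
  calc ‖v⁻¹‖ * ‖w⁻¹‖ ≤ 1 / 1.2 * (1 / 1.2) :=
        mul_le_mul (norm_inv_le_of_re hv) (norm_inv_le_of_re hw) (norm_nonneg _) (by norm_num)
    _ = 1 / 1.44 := by norm_num

theorem exists_riccati {ρ C : ℝ} (hρ : 0 < ρ) (s : ℝ) {t : ℂ → ℂ} (ht : IsStripFun ρ t)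
    (htre : ∀ z ∈ strip ρ, 2.05 ≤ (t z).re) (htC : ∀ z ∈ strip ρ, ‖t z‖ ≤ C) :
    ∃ r, IsStripFun ρ r ∧ (∀ z ∈ strip ρ, 1.2 ≤ (r z).re) ∧
      ∀ z ∈ strip ρ, t z - (r (z - s))⁻¹ = r z := by
  have hmem : ∀ w : ℂ, w ∈ {w : ℂ | 1.2 ≤ w.re} ↔ 1.2 ≤ w.re := fun w => by simp
  suffices h : ∃ r, IsStripFun ρ r ∧ (∀ z ∈ strip ρ, r z ∈ {w : ℂ | 1.2 ≤ w.re}) ∧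
      ∀ z ∈ strip ρ, t z - (r (z - s))⁻¹ = r z by
    obtain ⟨r, hr, hrB, hrT⟩ := h
    exact ⟨r, hr, fun z hz => (hmem _).1 (hrB z hz), hrT⟩
  refine exists_strip_fixedPoint (q := 1 / 1.44) (C := 2.5 + C) hρ
    (by norm_num) (by norm_num) (B := fun _ => {w : ℂ | 1.2 ≤ w.re})
    (fun _ => isClosed_le continuous_const Complex.continuous_re)
    (fun f z => t z - (f (z - s))⁻¹) ?_ ?_ (f₀ := fun _ => 2)
    ⟨differentiableOn_const _, fun _ _ => rfl, fun _ => by simp⟩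
    (fun _ _ => by rw [hmem]; norm_num) ?_
  · intro f hf hfB
    refine ⟨⟨?_, ?_, ?_⟩, ?_⟩
    · have hm : DifferentiableOn ℂ (fun z => f (z - s)) (strip ρ) :=
        hf.diff.comp (by fun_prop) fun z hz => sub_ofReal_mem_strip hz s
      exact ht.diff.sub (hm.inv fun z hz =>
        ne_zero_of_re ((hmem _).1 (hfB _ (sub_ofReal_mem_strip hz s))))
    · intro z hz
      rw [ht.periodic z hz, add_sub_right_comm z 1, hf.periodic _ (sub_ofReal_mem_strip hz s)]
    · intro x
      have h := hf.real (x - s)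
      rw [Complex.ofReal_sub] at h
      rw [Complex.sub_im, Complex.inv_im, ht.real, h]
      simp
    · intro z hz
      rw [hmem, Complex.sub_re]
      have h1 := (Complex.re_le_norm _).trans
        (norm_inv_le_of_re ((hmem _).1 (hfB _ (sub_ofReal_mem_strip hz s))))
      have h2 := htre z hz
      norm_num at *
      linarith
  · intro f g hf hg M hM z hz
    have hz' := sub_ofReal_mem_strip hz s
    rw [sub_sub_sub_cancel_left, norm_sub_rev]
    refine (norm_inv_sub_inv_le ((hmem _).1 (hf _ hz')) ((hmem _).1 (hg _ hz'))).trans ?_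
    exact mul_le_mul_of_nonneg_left (hM _ hz') (by norm_num)
  · intro z hz
    have e : (2 : ℂ) - (t z - (2 : ℂ)⁻¹) = 2.5 - t z := by norm_num; ring
    rw [e]
    refine (norm_sub_le _ _).trans (add_le_add ?_ (htC z hz))
    norm_num

/-! ### The golden mean is badly approximable -/

lemma golden_sub_int {ω : ℝ} (hω : ω = (Real.sqrt 5 - 1) / 2) {k : ℤ} (hk : k ≠ 0) (m : ℤ) :
    1 / (3 * |(k : ℝ)|) ≤ |k * ω - m| := by
  have h5 : Real.sqrt 5 ^ 2 = 5 := Real.sq_sqrt (by norm_num)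
  have h5l : 2.2 < Real.sqrt 5 := by
    rw [Real.lt_sqrt (by norm_num)]; norm_num
  have h5u : Real.sqrt 5 < 2.3 := by
    rw [Real.sqrt_lt' (by norm_num)]; norm_num
  have hω2 : ω ^ 2 + ω = 1 := by rw [hω]; nlinarith
  have hk1 : 1 ≤ |(k : ℝ)| := by exact_mod_cast Int.one_le_abs hk
  have hne : m ^ 2 + m * k - k ^ 2 ≠ 0 := by
    intro h
    have h1 : ((2 * m + k) ^ 2 : ℤ) = 5 * k ^ 2 := by linear_combination 4 * h
    have hirr : Irrational (Real.sqrt 5) := by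
      simpa using Nat.Prime.irrational_sqrt (by norm_num : Nat.Prime 5)
    apply hirr
    refine ⟨|(2 * m + k : ℚ)| / |(k : ℚ)|, ?_⟩
    have hkR : |(k : ℝ)| ≠ 0 := by positivity
    have h2 : (|(2 * m + k : ℝ)| / |(k : ℝ)|) ^ 2 = 5 := by
      rw [div_pow, sq_abs, sq_abs, div_eq_iff (by rw [← sq_abs]; positivity)]
      exact_mod_cast h1
    push_cast
    rw [← Real.sqrt_sq (by positivity : 0 ≤ |(2 * m + k : ℝ)| / |(k : ℝ)|), h2]
  have hge : (1 : ℝ) ≤ |((m ^ 2 + m * k - k ^ 2 : ℤ) : ℝ)| := by exact_mod_cast Int.one_le_abs hne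
  have hfac : ((m ^ 2 + m * k - k ^ 2 : ℤ) : ℝ) = -(k * ω - m) * (m + k * (1 + ω)) := by
    push_cast; linear_combination ((k : ℝ) ^ 2) * hω2
  by_contra! hlt
  have hlt1 : |k * ω - m| < 1 / 3 := by
    refine hlt.trans_le ?_
    gcongr
    linarith
  have hconj : |m + k * (1 + ω)| ≤ 3 * |(k : ℝ)| := by
    have e : m + k * (1 + ω) = -(k * ω - m) + k * (1 + 2 * ω) := by ring
    have h3 : |1 + 2 * ω| ≤ 2.3 := by
      rw [abs_le]; constructor <;> linarith
    rw [e]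
    refine (abs_add_le _ _).trans ?_
    rw [abs_neg, abs_mul]
    nlinarith [abs_nonneg (k : ℝ)]
  rw [hfac, abs_mul, abs_neg] at hge
  have h4 : |k * ω - m| * (3 * |(k : ℝ)|) < 1 := by
    rwa [lt_div_iff₀ (by positivity)] at hlt
  nlinarith [abs_nonneg (k * ω - m)]

lemma golden_small_divisor {ω : ℝ} (hω : ω = (Real.sqrt 5 - 1) / 2) {k : ℤ} (hk : k ≠ 0) :
    4 / (3 * |(k : ℝ)|) ≤ ‖Complex.exp (2 * Real.pi * Complex.I * k * ω) - 1‖ := by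
  have h := golden_sub_int hω hk (round (k * ω))
  set d := k * ω - round (k * ω) with hd
  have hd2 : |d| ≤ 1 / 2 := abs_sub_round _
  have e : Complex.exp (2 * Real.pi * Complex.I * k * ω)
      = Complex.exp (Complex.I * (2 * Real.pi * d : ℝ)) := by
    rw [Complex.exp_eq_exp_iff_exists_int]
    refine ⟨round (k * ω), ?_⟩
    rw [hd]; push_cast; ring
  rw [e, Complex.norm_exp_I_mul_ofReal_sub_one]
  rw [show 2 * Real.pi * d / 2 = Real.pi * d by ring, Real.norm_eq_abs, abs_mul, abs_two]
  have hs : 2 * |d| ≤ |Real.sin (Real.pi * d)| := by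
    have h1 := Real.mul_abs_le_abs_sin (x := Real.pi * d)
      (by rw [abs_mul, abs_of_pos Real.pi_pos]; nlinarith [Real.pi_pos])
    rw [abs_mul, abs_of_pos Real.pi_pos] at h1
    have h2 : 2 / Real.pi * (Real.pi * |d|) = 2 * |d| := by
      field_simp
    linarith
  have h3 : 4 / (3 * |(k : ℝ)|) = 4 * (1 / (3 * |(k : ℝ)|)) := by ring
  rw [h3]
  linarith

/-! ### The cohomological equation -/

lemma integral_strip_shift {ρ : ℝ} {f : ℂ → ℂ} (hf : DifferentiableOn ℂ f (strip ρ))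
    (hper : ∀ z ∈ strip ρ, f (z + 1) = f z) {y : ℝ} (hy : |y| < ρ) :
    ∫ x : ℝ in (0 : ℝ)..1, f x = ∫ x : ℝ in (0 : ℝ)..1, f (x + y * Complex.I) := by
  have hstrip : ∀ v ∈ Set.uIcc 0 y, ∀ u : ℝ, (u + v * Complex.I : ℂ) ∈ strip ρ := by
    intro v hv u
    have h1 : |v| ≤ |y| := by simpa using Set.abs_sub_left_of_mem_uIcc hv
    simpa [strip] using h1.trans_lt hy
  have h := Complex.integral_boundary_rect_eq_zero_of_differentiableOn f 0 (1 + y * Complex.I)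
    (hf.mono fun z hz => by
      rw [Complex.mem_reProdIm] at hz
      rw [← Complex.re_add_im z]
      exact hstrip _ (by simpa using hz.2) _)
  have hside : ∫ v : ℝ in (0 : ℝ)..y, f (1 + v * Complex.I)
      = ∫ v : ℝ in (0 : ℝ)..y, f (0 + v * Complex.I) := by
    refine intervalIntegral.integral_congr fun v hv => ?_
    have := hper _ (by simpa using hstrip v hv 0 : (0 + v * Complex.I : ℂ) ∈ strip ρ)
    rw [← this]
    congr 1
    ring
  simp only [Complex.zero_re, Complex.zero_im, Complex.add_re, Complex.one_re, Complex.mul_re,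
    Complex.ofReal_re, Complex.I_re, Complex.ofReal_im, Complex.I_im, Complex.add_im,
    Complex.one_im, Complex.mul_im, mul_zero, mul_one, zero_mul, sub_zero, add_zero, zero_add,
    Complex.ofReal_zero, Complex.ofReal_one] at h hside
  rw [hside] at h
  linear_combination h

/-- The Fourier mode of index `k`. -/
noncomputable def mode (k : ℤ) (z : ℂ) : ℂ := Complex.exp (2 * Real.pi * Complex.I * k * z)

lemma mode_add (k : ℤ) (z w : ℂ) : mode k (z + w) = mode k z * mode k w := by
  rw [mode, mode, mode, ← Complex.exp_add]; ring_nf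

lemma mode_one (k : ℤ) : mode k 1 = 1 := by
  rw [mode, Complex.exp_eq_one_iff]
  exact ⟨k, by ring⟩

lemma differentiable_mode (k : ℤ) : Differentiable ℂ (mode k) := by
  unfold mode; fun_prop

lemma norm_mode (k : ℤ) (z : ℂ) : ‖mode k z‖ = Real.exp (-(2 * Real.pi * k * z.im)) := by
  rw [mode, Complex.norm_exp]
  simp [Complex.mul_re, Complex.mul_im]

lemma norm_mode_le (k : ℤ) {z : ℂ} {σ : ℝ} (hz : |z.im| ≤ σ) :
    ‖mode k z‖ ≤ Real.exp (2 * Real.pi * σ * |(k : ℝ)|) := by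
  rw [norm_mode, Real.exp_le_exp]
  have h1 : -(k * z.im) ≤ |(k : ℝ)| * σ := by
    refine (neg_le_abs _).trans ?_
    rw [abs_mul]
    gcongr
  nlinarith [Real.pi_pos]

lemma norm_fourier_integral_le {ρ σ M : ℝ} {l : ℂ → ℂ} (hl : IsStripFun ρ l)
    (hM : ∀ z ∈ strip ρ, ‖l z‖ ≤ M) (hσ0 : 0 ≤ σ) (hσ : σ < ρ) (k : ℤ) :
    ‖∫ x : ℝ in (0 : ℝ)..1, mode (-k) x * l x‖ ≤ M * Real.exp (-(2 * Real.pi * σ * |(k : ℝ)|)) := by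
  obtain ⟨y, hy, hky⟩ : ∃ y : ℝ, |y| = σ ∧ k * y = -(σ * |(k : ℝ)|) := by
    rcases le_total 0 (k : ℝ) with h | h
    · exact ⟨-σ, by rw [abs_neg, abs_of_nonneg hσ0], by rw [abs_of_nonneg h]; ring⟩
    · exact ⟨σ, abs_of_nonneg hσ0, by rw [abs_of_nonpos h]; ring⟩
  rw [integral_strip_shift (f := fun z => mode (-k) z * l z)
    ((differentiable_mode _).differentiableOn.mul hl.diff)
    (fun z hz => by rw [hl.periodic z hz, mode_add, mode_one, mul_one])
    (hy.trans_lt hσ)]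
  have := intervalIntegral.norm_integral_le_of_norm_le_const (a := 0) (b := 1)
    (f := fun x : ℝ => mode (-k) (x + y * Complex.I) * l (x + y * Complex.I))
    (C := M * Real.exp (-(2 * Real.pi * σ * |(k : ℝ)|))) (fun x _ => by
      have hz : (x + y * Complex.I : ℂ) ∈ strip ρ := by simpa [strip] using hy.trans_lt hσ
      have hm : ‖mode (-k) (x + y * Complex.I)‖ = Real.exp (-(2 * Real.pi * σ * |(k : ℝ)|)) := by
        rw [norm_mode]
        congr 1
        simp
        linear_combination 2 * Real.pi * hky
      rw [norm_mul, hm, mul_comm]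
      exact mul_le_mul_of_nonneg_right (hM _ hz) (Real.exp_pos _).le)
  simpa using this

lemma summable_int_mul_exp {a : ℝ} (ha : 0 < a) :
    Summable fun k : ℤ => |(k : ℝ)| * Real.exp (-(a * |(k : ℝ)|)) := by
  have h : Summable fun n : ℕ => (n : ℝ) * Real.exp (-(a * n)) := by
    simpa using Real.summable_pow_mul_exp_neg_nat_mul 1 ha
  apply Summable.of_nat_of_neg <;> simpa using h

lemma summable_int_exp {a : ℝ} (ha : 0 < a) :
    Summable fun k : ℤ => Real.exp (-(a * |(k : ℝ)|)) := by
  have h : Summable fun n : ℕ => Real.exp (-(a * n)) := by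
    simpa using Real.summable_pow_mul_exp_neg_nat_mul 0 ha
  apply Summable.of_nat_of_neg <;> simpa using h

lemma hasSum_strip_fourier {ρ M : ℝ} (hρ : 0 < ρ) {l : ℂ → ℂ} (hl : IsStripFun ρ l)
    (hM : ∀ z ∈ strip ρ, ‖l z‖ ≤ M) (x : ℝ) :
    HasSum (fun k : ℤ => (∫ x : ℝ in (0 : ℝ)..1, mode (-k) x * l x) * mode k x) (l x) := by
  have : Fact (0 < (1 : ℝ)) := ⟨one_pos⟩
  have hper : Function.Periodic (fun x : ℝ => l x) 1 := fun x => by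
    simpa using hl.periodic x (ofReal_mem_strip hρ x)
  have hcont : Continuous fun x : ℝ => l x :=
    hl.diff.continuousOn.comp_continuous Complex.continuous_ofReal (ofReal_mem_strip hρ)
  let f : C(AddCircle (1 : ℝ), ℂ) := ⟨hper.lift, continuous_quot_lift _ hcont⟩
  have hf : ∀ x : ℝ, f (x : AddCircle (1 : ℝ)) = l x := fun x => rfl
  have hmode : ∀ (k : ℤ) (x : ℝ), fourier k (x : AddCircle (1 : ℝ)) = mode k x := fun k x => by
    rw [fourier_coe_apply, mode]; simp
  have hcoeff : ∀ k : ℤ, fourierCoeff f k = ∫ x : ℝ in (0 : ℝ)..1, mode (-k) x * l x := fun k => by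
    rw [fourierCoeff_eq_intervalIntegral f k 0]
    simp only [hmode, hf, smul_eq_mul, zero_add, div_one, one_smul]
  have hsum : Summable (fourierCoeff f) := by
    refine Summable.of_norm_bounded
      ((summable_int_exp (a := 2 * Real.pi * (ρ / 2)) (by positivity)).mul_left M) fun k => ?_
    rw [hcoeff]
    exact norm_fourier_integral_le hl hM (by positivity) (by linarith) k
  have h := has_pointwise_sum_fourier_series_of_summable hsum (x : AddCircle (1 : ℝ))
  simp only [hcoeff, hmode, hf, smul_eq_mul] at h
  exact h

theorem exists_cohomological {ρ M c s : ℝ} (hρ : 0 < ρ) {l : ℂ → ℂ} (hl : IsStripFun ρ l)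
    (hM : ∀ z ∈ strip ρ, ‖l z‖ ≤ M) (hc : 0 < c)
    (hs : ∀ k : ℤ, k ≠ 0 → c / |(k : ℝ)| ≤ ‖mode k s - 1‖) :
    ∃ (φ : ℝ → ℝ) (m : ℝ), (∀ x, AnalyticAt ℝ φ x) ∧ Function.Periodic φ 1 ∧
      ∀ x : ℝ, φ (x + s) - φ x = (l x).re - m := by
  let a : ℤ → ℂ := fun k => ∫ x : ℝ in (0 : ℝ)..1, mode (-k) x * l x
  have hM0 : 0 ≤ M := (norm_nonneg _).trans (hM _ (ofReal_mem_strip hρ 0))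
  let term : ℤ → ℂ → ℂ := fun k z => a k / (mode k s - 1) * mode k z
  let u : ℤ → ℝ := fun k => M / c * (|(k : ℝ)| * Real.exp (-(2 * Real.pi * (ρ / 4) * |(k : ℝ)|)))
  have hu : Summable u := (summable_int_mul_exp (by positivity)).mul_left _
  have hbound : ∀ (k : ℤ) (z : ℂ), z ∈ strip (ρ / 4) → ‖term k z‖ ≤ u k := by
    intro k z hz
    have hz' : |z.im| < ρ / 4 := by simpa [strip] using hz
    rcases eq_or_ne k 0 with rfl | hk
    · simp [term, u, mode]
    · have hk0 : 0 < |(k : ℝ)| := by positivity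
      have h1 := norm_fourier_integral_le hl hM (σ := ρ / 2) (by positivity) (by linarith) k
      have h2 := norm_mode_le k hz'.le
      have h3 := hs k hk
      have h4 : 0 < c / |(k : ℝ)| := by positivity
      calc ‖term k z‖ = ‖a k‖ / ‖mode k s - 1‖ * ‖mode k z‖ := by
            simp only [term]; rw [norm_mul, norm_div]
        _ ≤ M * Real.exp (-(2 * Real.pi * (ρ / 2) * |(k : ℝ)|)) / (c / |(k : ℝ)|)
            * Real.exp (2 * Real.pi * (ρ / 4) * |(k : ℝ)|) := by
            gcongr
        _ = M / c * (|(k : ℝ)| * (Real.exp (-(2 * Real.pi * (ρ / 2) * |(k : ℝ)|))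
            * Real.exp (2 * Real.pi * (ρ / 4) * |(k : ℝ)|))) := by
            field_simp
        _ = u k := by
            rw [← Real.exp_add]
            simp only [u]
            ring_nf
  let Φ : ℂ → ℂ := fun z => ∑' k, term k z
  have hΦ : DifferentiableOn ℂ Φ (strip (ρ / 4)) :=
    Complex.differentiableOn_tsum_of_summable_norm hu
      (fun k => ((differentiable_mode k).const_mul _).differentiableOn) (isOpen_strip _) hbound
  have hreal : ∀ x : ℝ, (x : ℂ) ∈ strip (ρ / 4) := ofReal_mem_strip (by positivity)
  have hsum : ∀ x : ℝ, HasSum (fun k => term k x) (Φ x) := fun x =>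
    (Summable.of_norm_bounded hu fun k => hbound k x (hreal x)).hasSum
  refine ⟨fun x => (Φ x).re, (a 0).re, fun x => ?_, fun x => ?_, fun x => ?_⟩
  · exact (hΦ.analyticAt ((isOpen_strip _).mem_nhds (hreal x))).re_ofReal
  · have : ∀ k, term k (x + 1) = term k x := fun k => by
      simp only [term]; rw [mode_add, mode_one, mul_one]
    simp only [Φ, Complex.ofReal_add, Complex.ofReal_one, this]
  · have h1 := (hsum (x + s)).sub (hsum x)
    have h2 := (hasSum_strip_fourier hρ hl hM x).sub (hasSum_ite_eq (0 : ℤ) (a 0))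
    have h3 : Φ (x + s : ℝ) - Φ x = l x - a 0 := by
      refine h1.unique (h2.congr_fun fun k => ?_)
      rcases eq_or_ne k 0 with rfl | hk
      · simp [term, mode, a]
      · have hne : mode k s - 1 ≠ 0 := by
          rw [← norm_pos_iff]
          exact lt_of_lt_of_le (by positivity) (hs k hk)
        simp only [term, if_neg hk, Complex.ofReal_add, mode_add, a]
        field_simp
        ring
    simpa using congrArg Complex.re h3

/-! ### Reduction of the cocycle to a constant multiplier -/

lemma exists_forall_le_of_periodic {f : ℝ → ℝ} (hf : Continuous f) (hper : Function.Periodic f 1) :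
    ∃ x, ∀ y, f y ≤ f x := by
  obtain ⟨x, -, hx⟩ := isCompact_Icc.exists_isMaxOn (Set.nonempty_Icc.2 zero_le_one)
    hf.continuousOn (s := Set.Icc (0 : ℝ) 1)
  refine ⟨x, fun y => ?_⟩
  obtain ⟨z, hz, hyz⟩ := hper.exists_mem_Ico₀ one_pos y
  rw [hyz]
  exact hx (Set.Ico_subset_Icc_self hz)

/-- A subsolution of the Riccati equation lies below the solution. -/
lemma riccati_comparison {T R g : ℝ → ℝ} {s : ℝ} (hR : Continuous R) (hg : Continuous g)
    (hRper : Function.Periodic R 1) (hgper : Function.Periodic g 1) (hR1 : ∀ x, 1.2 ≤ R x)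
    (hg0 : ∀ x, 0 < g x) (hReq : ∀ x, R x = T x - (R (x - s))⁻¹)
    (hgle : ∀ x, g x ≤ T x - (g (x - s))⁻¹) (x : ℝ) : g x ≤ R x := by
  obtain ⟨y, hy⟩ := exists_forall_le_of_periodic (hg.sub hR) (hgper.sub hRper)
  simp only [Pi.sub_apply] at hy
  suffices h : g y - R y ≤ 0 by linarith [hy x]
  by_contra! hpos
  have h1 := hReq y
  have h2 := hgle y
  have h3 := hR1 (y - s)
  have h4 := hg0 (y - s)
  have h5 := hy (y - s)
  set a := g (y - s)
  set b := R (y - s)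
  have hab : b⁻¹ - a⁻¹ = (a - b) / (a * b) := by field_simp
  have h6 : g y - R y ≤ (a - b) / (a * b) := by linarith
  have hab0 : 0 < a * b := by positivity
  have h7 : 0 < a - b := by
    by_contra! h
    have := div_nonpos_of_nonpos_of_nonneg h hab0.le
    linarith
  have h8 : 1.44 ≤ a * b := by nlinarith
  rw [le_div_iff₀ hab0] at h6
  nlinarith

theorem exists_reduction {ρ C c s lam₀ : ℝ} (hρ : 0 < ρ) {t : ℂ → ℂ} (ht : IsStripFun ρ t)
    (htre : ∀ z ∈ strip ρ, 2.05 ≤ (t z).re) (htC : ∀ z ∈ strip ρ, ‖t z‖ ≤ C) (hc : 0 < c)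
    (hs : ∀ k : ℤ, k ≠ 0 → c / |(k : ℝ)| ≤ ‖mode k s - 1‖) (hlam₀ : 0 < lam₀) {h : ℝ → ℝ}
    (hh : Continuous h) (hhper : Function.Periodic h 1) (hh0 : ∀ x, 0 < h x)
    (hsub : ∀ x : ℝ, lam₀ * h (x + s) + h (x - s) / lam₀ ≤ (t x).re * h x) :
    ∃ (w : ℝ → ℝ) (lam : ℝ), (∀ x, AnalyticAt ℝ w x) ∧ Function.Periodic w 1 ∧ (∀ x, 0 < w x) ∧
      lam₀ ≤ lam ∧ (∀ x, 1.2 * w x ≤ lam * w (x + s)) ∧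
      ∀ x : ℝ, lam * w (x + s) + w (x - s) / lam = (t x).re * w x := by
  obtain ⟨r, hr, hrre, hrT⟩ := exists_riccati hρ s ht htre htC
  have hrC : ∀ z ∈ strip ρ, ‖r z‖ ≤ C + 1 / 1.2 := fun z hz => by
    rw [← hrT z hz]
    exact (norm_sub_le _ _).trans (add_le_add (htC z hz)
      (norm_inv_le_of_re (hrre _ (sub_ofReal_mem_strip hz s))))
  have hrreal : ∀ x : ℝ, r x = ((r x).re : ℂ) := fun x => by
    apply Complex.ext <;> simp [hr.real x]
  let R : ℝ → ℝ := fun x => (r x).re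
  have hR1 : ∀ x, 1.2 ≤ R x := fun x => hrre x (ofReal_mem_strip hρ x)
  have hR0 : ∀ x, 0 < R x := fun x => lt_of_lt_of_le (by norm_num) (hR1 x)
  have hRcont : Continuous R := Complex.continuous_re.comp
    (hr.diff.continuousOn.comp_continuous Complex.continuous_ofReal (ofReal_mem_strip hρ))
  have hRper : Function.Periodic R 1 := fun x => by
    simp only [R, Complex.ofReal_add, Complex.ofReal_one]
    rw [hr.periodic x (ofReal_mem_strip hρ x)]
  have hReq : ∀ x, R x = (t x).re - (R (x - s))⁻¹ := fun x => by
    have h1 := hrT x (ofReal_mem_strip hρ x)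
    rw [← Complex.ofReal_sub, hrreal (x - s), ← Complex.ofReal_inv] at h1
    have h2 := congrArg Complex.re h1
    rw [Complex.sub_re, Complex.ofReal_re] at h2
    exact h2.symm
  have hl : IsStripFun ρ fun z => Complex.log (r z) := by
    refine ⟨hr.diff.clog fun z hz => Or.inl ?_, fun z hz => ?_, fun x => ?_⟩
    · exact lt_of_lt_of_le (by norm_num) (hrre z hz)
    · rw [hr.periodic z hz]
    · rw [Complex.log_im, hrreal, Complex.arg_ofReal_of_nonneg (hR0 x).le]
  have hlM : ∀ z ∈ strip ρ, ‖Complex.log (r z)‖ ≤ C + 1 / 1.2 + Real.pi := fun z hz => by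
    refine (Complex.norm_le_abs_re_add_abs_im _).trans (add_le_add ?_ ?_)
    · have h1 : 1 ≤ ‖r z‖ := by
        have := (hrre z hz).trans (Complex.re_le_norm _)
        norm_num at this
        linarith
      rw [Complex.log_re, abs_of_nonneg (Real.log_nonneg h1)]
      exact ((Real.log_le_sub_one_of_pos (by linarith)).trans (by linarith)).trans (hrC z hz)
    · rw [Complex.log_im]
      exact Complex.abs_arg_le_pi _
  obtain ⟨φ, m, hφan, hφper, hφ⟩ := exists_cohomological hρ hl hlM hc hs
  have hφR : ∀ x, φ (x + s) - φ x = Real.log (R x) - m := fun x => by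
    rw [hφ, Complex.log_re, hrreal, Complex.norm_real, Real.norm_of_nonneg (hR0 x).le]
  have hstep : ∀ x, Real.exp m * Real.exp (φ (x + s)) = R x * Real.exp (φ x) := fun x => by
    rw [← Real.exp_log (hR0 x), ← Real.exp_add, ← Real.exp_add]
    congr 1
    linarith [hφR x]
  have hφcont : Continuous φ := continuous_iff_continuousAt.2 fun x => (hφan x).continuousAt
  have hgR : ∀ x, lam₀ * h (x + s) / h x ≤ R x := by
    refine riccati_comparison (T := fun x => (t x).re) (s := s) hRcont ?_ hRper ?_ hR1 ?_ hReq ?_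
    · exact (continuous_const.mul (hh.comp (continuous_id.add continuous_const))).div hh
        fun x => (hh0 x).ne'
    · intro x
      simp only [add_right_comm x 1 s, hhper _]
    · intro x
      have := hh0 x
      have := hh0 (x + s)
      positivity
    · intro x
      have h0 := hh0 x
      have h1 := hh0 (x - s)
      rw [sub_add_cancel, inv_div, le_sub_iff_add_le, ← mul_le_mul_iff_left₀ h0]
      refine le_trans (le_of_eq ?_) (hsub x)
      field_simp
  refine ⟨fun x => Real.exp (φ x), Real.exp m, fun x => (hφan x).rexp, fun x => ?_,
    fun x => Real.exp_pos _, ?_, fun x => ?_, fun x => ?_⟩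
  · simp only [hφper x]
  · obtain ⟨y, hy⟩ := exists_forall_le_of_periodic
      (f := fun x => Real.exp (φ x) / h x) (by
        exact (Real.continuous_exp.comp hφcont).div hh fun x => (hh0 x).ne')
      (fun x => by simp only [hφper x, hhper x])
    have h1 := hy (y + s)
    have h2 := hstep y
    have h3 := hgR y
    have h4 := hh0 y
    have h5 := hh0 (y + s)
    have h6 := Real.exp_pos (φ (y + s))
    have h7 := Real.exp_pos (φ y)
    rw [div_le_div_iff₀ h5 h4] at h1
    rw [div_le_iff₀ h4] at h3
    by_contra! hlt
    have h8 : Real.exp m * Real.exp (φ (y + s)) * h y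
        < lam₀ * Real.exp (φ (y + s)) * h y := by gcongr
    have h9 : lam₀ * (Real.exp (φ (y + s)) * h y) ≤ lam₀ * (Real.exp (φ y) * h (y + s)) := by
      gcongr
    have h10 : lam₀ * h (y + s) * Real.exp (φ y) ≤ R y * h y * Real.exp (φ y) := by gcongr
    rw [h2] at h8
    linarith
  · rw [hstep]
    exact mul_le_mul_of_nonneg_right (hR1 x) (Real.exp_pos _).le
  · have h1 := hstep (x - s)
    rw [sub_add_cancel] at h1
    have h2 := hR0 (x - s)
    have h3 : Real.exp (φ (x - s)) / Real.exp m = (R (x - s))⁻¹ * Real.exp (φ x) := by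
      have := Real.exp_pos m
      field_simp
      linarith
    rw [hstep, h3, hReq x]
    ring

/-! ### The hyperbolic torus -/

lemma mode_small_divisor {ω : ℝ} (hω : ω = (Real.sqrt 5 - 1) / 2) (k : ℤ) (hk : k ≠ 0) :
    4 / 3 / |(k : ℝ)| ≤ ‖mode k ω - 1‖ := by
  rw [div_div]
  exact golden_small_divisor hω hk

lemma mode_small_divisor_neg {ω : ℝ} (hω : ω = (Real.sqrt 5 - 1) / 2) (k : ℤ) (hk : k ≠ 0) :
    4 / 3 / |(k : ℝ)| ≤ ‖mode k (-ω : ℝ) - 1‖ := by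
  have h := mode_small_divisor hω (-k) (neg_ne_zero.2 hk)
  have e : mode (-k) ω = mode k (-ω : ℝ) := by simp [mode]
  rwa [e, Int.cast_neg, abs_neg] at h

/-- For ω the golden mean, κ = 1.3, ε = 1, the perturbed standard map has
a real-analytic, 1-periodic fiberwise hyperbolic invariant torus with constant diagonal
reduced linearized dynamics, with `|λ_s| ≤ 0.447` and `|λ_u| ≥ 2.237`. -/
theorem hyperbolic_torus_eps (ω : ℝ) (hω : ω = (Real.sqrt 5 - 1) / 2) :
    ∃ (K : ℝ → ℝ × ℝ) (P : ℝ → Matrix (Fin 2) (Fin 2) ℝ) (lams lamu : ℝ),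
      (∀ θ : ℝ, AnalyticAt ℝ K θ) ∧ Function.Periodic K 1 ∧
      (∀ θ : ℝ, stdF 1.3 1 (K (θ - ω)).1 (K (θ - ω)).2 (θ - ω) = K θ) ∧
      (∀ (i j : Fin 2) (θ : ℝ), AnalyticAt ℝ (fun t => P t i j) θ) ∧
      Function.Periodic P 1 ∧
      (∀ θ : ℝ, IsUnit (P θ)) ∧
      |lams| ≤ 0.447 ∧ 2.237 ≤ |lamu| ∧ |lams| < 1 ∧ 1 < |lamu| ∧
      (∀ θ : ℝ,
        stdDF 1.3 (K (θ - ω)).1 * P (θ - ω) = P θ * Matrix.diagonal ![lams, lamu]) := by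
  obtain ⟨ρ, hρ, U, hU, hUbox, hUA, hUeq⟩ := exists_torus hω
  have hUreal : ∀ x : ℝ, U x = ((U x).re : ℂ) := fun x => by
    apply Complex.ext <;> simp [hU.real x]
  let t : ℂ → ℂ := fun z => 2 + 1.3 * Complex.cos (U z)
  have htx : ∀ x : ℝ, t x = ((2 + 1.3 * Real.cos (U x).re : ℝ) : ℂ) := fun x => by
    simp only [t]
    push_cast
    rw [← hUreal]
  have htre_real : ∀ x : ℝ, (t x).re = 2 + 1.3 * Real.cos (U x).re := fun x => by
    rw [htx, Complex.ofReal_re]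
  have ht : IsStripFun ρ t := by
    refine ⟨(differentiableOn_const _).add (hU.diff.ccos.const_mul _), fun z hz => ?_, fun x => ?_⟩
    · simp only [t, hU.periodic z hz]
    · rw [htx, Complex.ofReal_im]
  have htcos : ∀ z, (t z).re = 2 + 1.3 * (Complex.cos (U z)).re := fun z => by
    simp only [t]
    norm_num [Complex.add_re, Complex.mul_re]
  have htre : ∀ z ∈ strip ρ, 2.05 ≤ (t z).re := fun z hz => by
    obtain ⟨h1, -, -⟩ := cos_bounds_of_mem_torusBox (hUbox z hz)
    rw [htcos]
    norm_num at h1 ⊢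
    linarith
  have htC : ∀ z ∈ strip ρ, ‖t z‖ ≤ 5 := fun z hz => by
    obtain ⟨h1, h2, h3⟩ := cos_bounds_of_mem_torusBox (hUbox z hz)
    have h4 : ‖Complex.cos (U z)‖ ≤ 1.000001 + 0.0015 :=
      (Complex.norm_le_abs_re_add_abs_im _).trans
        (add_le_add (abs_le.2 ⟨by norm_num at h1 ⊢; linarith, h2⟩) h3)
    have h5 := norm_add_le (2 : ℂ) (1.3 * Complex.cos (U z))
    rw [norm_mul] at h5
    norm_num at h4 h5 ⊢
    simp only [t]
    norm_num
    linarith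
  have hAcos : ∀ x : ℝ, 1.3 * Real.cos (approxTorus ((2 * Real.pi * x : ℝ) : ℂ)).re - 1.3 * 0.0001
      ≤ 1.3 * Real.cos (U x).re := fun x => by
    have h1 := (Complex.abs_re_le_norm _).trans (hUA x)
    have h2 := Real.abs_cos_sub_cos_le (approxTorus (2 * Real.pi * x)).re (U x).re
    rw [Complex.sub_re, abs_sub_comm] at h1
    have h3 := (abs_le.1 (h2.trans h1)).2
    push_cast
    linarith
  have hsub_plus : ∀ x : ℝ, 2.23714 * weight (2 * Real.pi * (x + ω))
      + weight (2 * Real.pi * (x - ω)) / 2.23714 ≤ (t x).re * weight (2 * Real.pi * x) := by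
    intro x
    rw [htre_real, mul_add, mul_sub]
    refine (weight_subsolution hω (2 * Real.pi * x)).trans
      (mul_le_mul_of_nonneg_right ?_ (by linarith [weight_ge (2 * Real.pi * x)]))
    linarith [hAcos x]
  have hsub_minus : ∀ x : ℝ, 2.23714 * weight (-(2 * Real.pi * (x + -ω)))
      + weight (-(2 * Real.pi * (x - -ω))) / 2.23714 ≤ (t x).re * weight (-(2 * Real.pi * x)) := by
    intro x
    rw [htre_real, show -(2 * Real.pi * (x + -ω)) = -(2 * Real.pi * x) + 2 * Real.pi * ω by ring,
      show -(2 * Real.pi * (x - -ω)) = -(2 * Real.pi * x) - 2 * Real.pi * ω by ring]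
    refine (weight_subsolution hω (-(2 * Real.pi * x))).trans
      (mul_le_mul_of_nonneg_right ?_ (by linarith [weight_ge (-(2 * Real.pi * x))]))
    rw [Complex.ofReal_neg, approxTorus_neg, Complex.neg_re, Real.cos_neg]
    linarith [hAcos x]
  have hw0 : ∀ x, 0 < weight x := fun x => lt_of_lt_of_le (by norm_num) (weight_ge x)
  obtain ⟨w, lu, hwan, hwper, hwpos, hlu, hwgrow, hweq⟩ := exists_reduction hρ ht htre htC
    (by norm_num) (mode_small_divisor hω) (by norm_num)
    (h := fun x => weight (2 * Real.pi * x)) (continuous_weight.comp (by fun_prop))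
    (fun x => by simp only [mul_add, mul_one, weight_periodic _]) (fun x => hw0 _) hsub_plus
  obtain ⟨v, ls, hvan, hvper, hvpos, hls, hvgrow, hveq⟩ := exists_reduction hρ ht htre htC
    (by norm_num) (mode_small_divisor_neg hω) (by norm_num)
    (h := fun x => weight (-(2 * Real.pi * x))) (continuous_weight.comp (by fun_prop))
    (fun x => by simp only [mul_add, mul_one, neg_add, ← sub_eq_add_neg, weight_periodic.sub_eq])
    (fun x => hw0 _) hsub_minus
  have hlu0 : 0 < lu := lt_of_lt_of_le (by norm_num) hlu
  have hls0 : 0 < ls := lt_of_lt_of_le (by norm_num) hls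
  have hls447 : |ls⁻¹| ≤ 0.447 := by
    rw [abs_of_pos (inv_pos.2 hls0)]
    exact (inv_anti₀ (by norm_num) hls).trans (by norm_num)
  have hlu2237 : 2.237 ≤ |lu| := by
    rw [abs_of_pos hlu0]
    exact le_trans (by norm_num) hlu
  have hUan : ∀ x, AnalyticAt ℝ (fun x : ℝ => (U x).re) x := fun x =>
    (hU.diff.analyticAt ((isOpen_strip ρ).mem_nhds (ofReal_mem_strip hρ x))).re_ofReal
  have hUper : ∀ x : ℝ, (U (x + 1 : ℝ)).re = (U x).re := fun x => by
    rw [Complex.ofReal_add, Complex.ofReal_one, hU.periodic x (ofReal_mem_strip hρ x)]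
  have hshift : ∀ {f : ℝ → ℝ}, (∀ x, AnalyticAt ℝ f x) →
      ∀ x, AnalyticAt ℝ (fun y => f (y - ω)) x := fun hf x =>
    (hf (x - ω)).comp_of_eq (analyticAt_id.sub analyticAt_const) rfl
  have hUre : ∀ x : ℝ, (U (x + ω : ℝ)).re + (U (x - ω : ℝ)).re - 2 * (U x).re
      - 1.3 * Real.sin (U x).re + 2 * Real.pi * Real.sin (2 * Real.pi * x) = 0 := fun x => by
    have h1 := hUeq x (ofReal_mem_strip hρ x)
    rw [← Complex.ofReal_add, ← Complex.ofReal_sub, hUreal x, hUreal (x + ω), hUreal (x - ω)] at h1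
    apply Complex.ofReal_injective
    push_cast at h1 ⊢
    exact h1
  have hcosx : ∀ u : ℝ, Real.cos (2 * Real.pi * (1 / 2 + u / (2 * Real.pi))) = -Real.cos u := by
    intro u
    rw [show 2 * Real.pi * (1 / 2 + u / (2 * Real.pi)) = u + Real.pi by field_simp; ring,
      Real.cos_add_pi]
  have hsinx : ∀ u : ℝ, Real.sin (2 * Real.pi * (1 / 2 + u / (2 * Real.pi))) = -Real.sin u := by
    intro u
    rw [show 2 * Real.pi * (1 / 2 + u / (2 * Real.pi)) = u + Real.pi by field_simp; ring,
      Real.sin_add_pi]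
  refine ⟨fun θ => (1 / 2 + (U θ).re / (2 * Real.pi),
      ((U θ).re - (U (θ - ω : ℝ)).re) / (2 * Real.pi)),
    fun θ => !![v θ, w θ; v θ - ls * v (θ - ω), w θ - w (θ - ω) / lu], ls⁻¹, lu,
    fun θ => ?_, fun θ => ?_, fun θ => ?_, fun i j θ => ?_, fun θ => ?_, fun θ => ?_,
    hls447, hlu2237, lt_of_le_of_lt hls447 (by norm_num),
    lt_of_lt_of_le (by norm_num) hlu2237, fun θ => ?_⟩
  · exact (analyticAt_const.add ((hUan θ).div_const)).prod
      (((hUan θ).sub (hshift hUan θ)).div_const)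
  · have h1 := hUper (θ - ω)
    rw [← add_sub_right_comm] at h1
    simp only [hUper θ, h1]
  · have h1 := hUre (θ - ω)
    rw [sub_add_cancel] at h1
    have hpi := Real.pi_pos
    simp only [stdF, hsinx]
    generalize Real.sin (2 * Real.pi * (θ - ω)) = S at h1 ⊢
    refine Prod.ext ?_ ?_
    · simp only
      field_simp
      linear_combination -h1
    · simp only
      field_simp
      linear_combination -h1
  · fin_cases i <;> fin_cases j
    · simpa using hvan θ
    · simpa using hwan θ
    · exact (hvan θ).sub (analyticAt_const.mul (hshift hvan θ))
    · exact (hwan θ).sub ((hshift hwan θ).div_const)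
  · simp only [hvper θ, hwper θ, add_sub_right_comm θ 1 ω, hvper (θ - ω), hwper (θ - ω)]
  · rw [Matrix.isUnit_iff_isUnit_det, Matrix.det_fin_two_of, isUnit_iff_ne_zero]
    have h1 := hwgrow (θ - ω)
    have h2 := hvgrow θ
    rw [sub_add_cancel] at h1
    rw [← sub_eq_add_neg] at h2
    have h3 : w (θ - ω) / lu ≤ w θ / 1.2 := by
      rw [div_le_div_iff₀ hlu0 (by norm_num)]
      linarith
    have h4 := mul_pos (hvpos θ) (hwpos θ)
    have h5 := mul_le_mul_of_nonneg_left h3 (hvpos θ).le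
    have h6 := mul_le_mul_of_nonneg_left h2 (hwpos θ).le
    apply ne_of_gt
    norm_num at h5 h6
    nlinarith
  · have h1 := hweq (θ - ω)
    have h2 := hveq (θ - ω)
    rw [htre_real, sub_add_cancel] at h1
    rw [htre_real, sub_neg_eq_add, sub_add_cancel, ← sub_eq_add_neg] at h2
    have h3 : ls⁻¹ * ls = 1 := inv_mul_cancel₀ hls0.ne'
    have h4 : lu⁻¹ * lu = 1 := inv_mul_cancel₀ hlu0.ne'
    simp only [div_eq_mul_inv] at h1 h2
    simp only [stdDF, hcosx]
    generalize Real.cos (U (θ - ω : ℝ)).re = S at h1 h2 ⊢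
    ext i j
    fin_cases i <;> fin_cases j <;> simp [Matrix.mul_apply, Fin.sum_univ_two]
    · linear_combination -h2
    · simp only [div_eq_mul_inv]
      linear_combination -h1
    · linear_combination -h2 + v (θ - ω) * h3
    · simp only [div_eq_mul_inv]
      linear_combination -h1 + w (θ - ω) * h4
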